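/- arXiv:2311.09643 — 3 statements merged into one kernel-verified Lean document; each statement's English description precedes it below -/
import Mathlib

section
/- Let N > 3 be an odd integer. Then the dual billiard map f_{Π_N} outside the regular N-gon has an aperiodic point if and only if the dual billiard map f_{Π_{2N}} outside the regular 2N-gon has an aperiodic point. -/
open Complex

noncomputable section

/-- `w` lies strictly on the right of the oriented line from `z` to `a`. -/
def StrictlyRight (z a w : ℂ) : Prop := ((starRingEnd ℂ) (a - z) * (w - z)).im < 0

/-- `z` is an aperiodic point of the (left) dual billiard map outside the regular `M`-gon
(the interior of the convex hull of the `M`-th roots of unity): there is an injective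
bi-infinite orbit through `z`, where at each step the map reflects in the unique vertex `a`
such that all other vertices lie strictly on the right of the oriented line from the current
point to `a`. -/
def IsAperiodicPt (M : ℕ) (z : ℂ) : Prop :=
  ∃ g : ℤ → ℂ, Function.Injective g ∧ g 0 = z ∧
    ∀ n : ℤ, ∃ a : ℂ, a ^ M = 1 ∧
      (∀ b : ℂ, b ^ M = 1 → b ≠ a → StrictlyRight (g n) a b) ∧
      g (n + 1) = 2 * a - g n

open Relation

/-! ### Bi-infinite orbits of relations -/

/-- If every point of `Y` has a successor and a predecessor in `Y`, then every point of `Y` lies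
on a bi-infinite orbit inside `Y`. -/
theorem exists_int_orbit {α : Type*} {R : α → α → Prop} {Y : Set α}
    (hs : ∀ y ∈ Y, ∃ y' ∈ Y, R y y') (hp : ∀ y ∈ Y, ∃ y' ∈ Y, R y' y) {y₀ : α} (h₀ : y₀ ∈ Y) :
    ∃ g : ℤ → α, g 0 = y₀ ∧ (∀ n, g n ∈ Y) ∧ ∀ n, R (g n) (g (n + 1)) := by
  choose! s hsY hsR using hs
  choose! p hpY hpR using hp
  have hS : ∀ n : ℕ, s^[n] y₀ ∈ Y := by
    intro n
    induction n with
    | zero => exact h₀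
    | succ n ih => rw [Function.iterate_succ_apply']; exact hsY _ ih
  have hP : ∀ n : ℕ, p^[n] y₀ ∈ Y := by
    intro n
    induction n with
    | zero => exact h₀
    | succ n ih => rw [Function.iterate_succ_apply']; exact hpY _ ih
  refine ⟨fun n => match n with
    | Int.ofNat m => s^[m] y₀
    | Int.negSucc m => p^[m + 1] y₀, rfl, ?_, ?_⟩
  · rintro (m | m)
    · exact hS m
    · exact hP (m + 1)
  · rintro (m | m)
    · change R (s^[m] y₀) (s^[m + 1] y₀)
      rw [Function.iterate_succ_apply']
      exact hsR _ (hS m)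
    · cases m with
      | zero => exact hpR _ h₀
      | succ m =>
        change R (p^[m + 1 + 1] y₀) (p^[m + 1] y₀)
        rw [Function.iterate_succ_apply' p (m + 1)]
        exact hpR _ (hP (m + 1))

theorem transGen_orbit {α : Type*} {R : α → α → Prop} {g : ℤ → α}
    (hg : ∀ n, R (g n) (g (n + 1))) (n : ℤ) (p : ℕ) : TransGen R (g n) (g (n + p + 1)) := by
  induction p with
  | zero => simpa using TransGen.single (hg n)
  | succ p ih =>
    refine ih.tail ?_
    have := hg (n + p + 1)
    rwa [show n + ((p + 1 : ℕ) : ℤ) + 1 = n + p + 1 + 1 by push_cast; ring]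

theorem exists_later_of_transGen {α : Type*} {R : α → α → Prop} (hR : Relator.RightUnique R)
    {g : ℤ → α} (hg : ∀ n, R (g n) (g (n + 1))) {n : ℤ} {y : α} (h : TransGen R (g n) y) :
    ∃ m, n < m ∧ y = g m := by
  induction h with
  | single h => exact ⟨n + 1, by omega, hR h (hg n)⟩
  | tail _ h ih =>
    obtain ⟨m, hm, rfl⟩ := ih
    exact ⟨m + 1, by omega, hR h (hg m)⟩

theorem exists_earlier_of_transGen {α : Type*} {R : α → α → Prop} (hR : Relator.LeftUnique R)
    {g : ℤ → α} (hg : ∀ n, R (g n) (g (n + 1))) {n : ℤ} {y : α} (h : TransGen R y (g n)) :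
    ∃ m, m < n ∧ y = g m := by
  have aux : ∀ m, ∀ y, R y (g m) → y = g (m - 1) := fun m y hy =>
    hR hy (by simpa using hg (m - 1))
  induction h using TransGen.head_induction_on with
  | single h => exact ⟨n - 1, by omega, aux _ _ h⟩
  | head h _ ih =>
    obtain ⟨m, hm, rfl⟩ := ih
    exact ⟨m - 1, by omega, aux _ _ h⟩

/-- A point on a cycle of a deterministic relation reaches only finitely many points. -/
theorem finite_reachable_of_cycle {α : Type*} {R : α → α → Prop} (hR : Relator.RightUnique R)
    {y : α} (h : TransGen R y y) : {w | TransGen R y w}.Finite := by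
  classical
  let T : α → α := fun z => if hz : ∃ z', R z z' then hz.choose else z
  have hT : ∀ {z z'}, R z z' → T z = z' := by
    intro z z' hz
    have hex : ∃ z', R z z' := ⟨z', hz⟩
    simp only [T, dif_pos hex]
    exact hR hex.choose_spec hz
  have hit : ∀ {w}, TransGen R y w → ∃ n : ℕ, 0 < n ∧ T^[n] y = w := by
    intro w hw
    induction hw with
    | single h => exact ⟨1, one_pos, hT h⟩
    | tail _ h ih =>
      obtain ⟨n, _, rfl⟩ := ih
      exact ⟨n + 1, n.succ_pos, by rw [Function.iterate_succ_apply']; exact hT h⟩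
  obtain ⟨L, hL, hper⟩ := hit h
  refine ((Finset.range L).image fun n => T^[n] y).finite_toSet.subset fun w hw => ?_
  obtain ⟨n, _, rfl⟩ := hit hw
  have hP : Function.IsPeriodicPt T L y := hper
  simp only [Finset.coe_image, Set.mem_image, Finset.mem_coe, Finset.mem_range]
  exact ⟨n % L, Nat.mod_lt _ hL, hP.iterate_mod_apply n⟩

/-- A set closed under successors and predecessors together with a point of it on no cycle. -/
def HasAcyclicOrbit {α : Type*} (R : α → α → Prop) : Prop :=
  ∃ Y : Set α, (∀ y ∈ Y, ∃ y' ∈ Y, R y y') ∧ (∀ y ∈ Y, ∃ y' ∈ Y, R y' y) ∧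
    ∃ y ∈ Y, ¬ TransGen R y y

/-- Interpolating an injective sequence by paths of a deterministic relation. -/
theorem hasAcyclicOrbit_of_transGen {α : Type*} {R : α → α → Prop} (hR : Relator.RightUnique R)
    {x : ℤ → α} (hx : Function.Injective x) (h : ∀ n, TransGen R (x n) (x (n + 1))) :
    HasAcyclicOrbit R := by
  refine ⟨{y | ∃ n, ReflTransGen R (x n) y ∧ TransGen R y (x (n + 1))}, ?_, ?_,
    x 0, ⟨0, ReflTransGen.refl, h 0⟩, ?_⟩
  · rintro y ⟨n, hy, hy'⟩
    obtain ⟨w, hw, hw'⟩ := TransGen.head'_iff.1 hy'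
    rcases reflTransGen_iff_eq_or_transGen.1 hw' with rfl | hw''
    · exact ⟨_, ⟨n + 1, ReflTransGen.refl, h _⟩, hw⟩
    · exact ⟨w, ⟨n, hy.tail hw, hw''⟩, hw⟩
  · rintro y ⟨n, hy, hy'⟩
    rcases ReflTransGen.cases_tail hy with rfl | ⟨w, hw, hwy⟩
    · have h1 := h (n - 1)
      rw [sub_add_cancel] at h1
      obtain ⟨w, hw, hw'⟩ := TransGen.tail'_iff.1 h1
      exact ⟨w, ⟨n - 1, hw, by simpa using TransGen.single hw'⟩, hw'⟩
    · exact ⟨w, ⟨n, hw, TransGen.head hwy hy'⟩, hwy⟩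
  · intro hc
    have hreach : ∀ n : ℕ, TransGen R (x 0) (x n) := by
      intro n
      induction n with
      | zero => exact hc
      | succ n ih => exact ih.trans (by simpa using h n)
    exact Set.infinite_of_injective_forall_mem (f := fun n : ℕ => x n)
      (fun a b hab => by simpa using hx hab) hreach (finite_reachable_of_cycle hR hc)

/-! ### Reduction modulo rotations -/

/-- The points whose tangency vertex with respect to the regular `M`-gon is `1`. -/
def TangentCone (M : ℕ) (z : ℂ) : Prop := ∀ b : ℂ, b ^ M = 1 → b ≠ 1 → StrictlyRight z 1 b

/-- The dual billiard map outside the regular `M`-gon. -/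
def DualBilliard (M : ℕ) (z z' : ℂ) : Prop :=
  ∃ a : ℂ, a ^ M = 1 ∧ (∀ b : ℂ, b ^ M = 1 → b ≠ a → StrictlyRight z a b) ∧ z' = 2 * a - z

/-- The dual billiard map modulo the rotations of the `M`-gon, as a map of the tangent cone
at the vertex `1`. -/
def ReducedBilliard (M : ℕ) (z z' : ℂ) : Prop :=
  TangentCone M z ∧ TangentCone M z' ∧ ∃ ρ : ℂ, (-ρ) ^ M = 1 ∧ z' = ρ * (z - 2)

theorem im_conj_mul_swap (z a b : ℂ) :
    ((starRingEnd ℂ) (a - z) * (b - z)).im = -((starRingEnd ℂ) (b - z) * (a - z)).im := by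
  simp only [mul_im, conj_re, conj_im, sub_re, sub_im]
  ring

theorem StrictlyRight.asymm {z a b : ℂ} (h : StrictlyRight z a b) : ¬ StrictlyRight z b a := by
  unfold StrictlyRight at *
  rw [im_conj_mul_swap] at h
  linarith

theorem strictlyRight_mul_iff {ρ : ℂ} (hρ : ‖ρ‖ = 1) (z a b : ℂ) :
    StrictlyRight (ρ * z) (ρ * a) (ρ * b) ↔ StrictlyRight z a b := by
  have h : (starRingEnd ℂ) ρ * ρ = 1 := by
    rw [← normSq_eq_conj_mul_self, normSq_eq_norm_sq, hρ]; norm_num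
  unfold StrictlyRight
  rw [← mul_sub, ← mul_sub, map_mul, show ∀ p q r s : ℂ, p * q * (r * s) = p * r * (q * s) by
    intros; ring, h, one_mul]

theorem ne_zero_of_pow_eq_one {M : ℕ} (hM : M ≠ 0) {a : ℂ} (ha : a ^ M = 1) : a ≠ 0 := by
  rintro rfl
  simp [hM] at ha

/-- `a` is the tangency vertex of `z` if and only if rotating `a` to `1` brings `z` to the
tangent cone. -/
theorem tangent_iff_tangentCone {M : ℕ} (hM : M ≠ 0) {a : ℂ} (ha : a ^ M = 1) (z : ℂ) :
    (∀ b : ℂ, b ^ M = 1 → b ≠ a → StrictlyRight (a * z) a b) ↔ TangentCone M z := by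
  have ha0 := ne_zero_of_pow_eq_one hM ha
  have hn := norm_eq_one_of_pow_eq_one ha hM
  constructor
  · intro h b hb hb1
    rw [← strictlyRight_mul_iff hn, mul_one]
    exact h _ (by rw [mul_pow, ha, hb, one_mul]) (by simpa [ha0] using hb1)
  · intro h b hb hba
    have h1 := h (a⁻¹ * b) (by rw [mul_pow, inv_pow, ha, hb]; simp)
      (by intro h2; exact hba (by rw [inv_mul_eq_one₀ ha0] at h2; exact h2.symm))
    rw [← strictlyRight_mul_iff hn, mul_one, mul_inv_cancel_left₀ ha0] at h1
    exact h1

theorem eq_one_of_tangentCone_mul {M : ℕ} (hM : M ≠ 0) {z σ : ℂ}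
    (hz : ∀ b : ℂ, b ^ M = 1 → ((starRingEnd ℂ) (1 - z) * (b - z)).im ≤ 0)
    (hσ : σ ^ M = 1) (h : TangentCone M (σ * z)) : σ = 1 := by
  by_contra hne
  have h0 := ne_zero_of_pow_eq_one hM hσ
  have hi : (σ⁻¹) ^ M = 1 := by rw [inv_pow, hσ, inv_one]
  have h1 := (tangent_iff_tangentCone hM hi (σ * z)).2 h 1 (one_pow M)
    (by simpa [eq_comm] using hne)
  rw [inv_mul_cancel_left₀ h0] at h1
  have h2 := hz _ hi
  unfold StrictlyRight at h1
  rw [im_conj_mul_swap] at h1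
  linarith

theorem TangentCone.im_nonpos {M : ℕ} {z : ℂ} (h : TangentCone M z) (b : ℂ) (hb : b ^ M = 1) :
    ((starRingEnd ℂ) (1 - z) * (b - z)).im ≤ 0 := by
  by_cases h1 : b = 1
  · subst h1
    simp [mul_comm]
  · exact (h b hb h1).le

theorem TangentCone.eq_one_of_mul {M : ℕ} (hM : M ≠ 0) {z σ : ℂ} (hz : TangentCone M z)
    (hσ : σ ^ M = 1) (h : TangentCone M (σ * z)) : σ = 1 :=
  eq_one_of_tangentCone_mul hM hz.im_nonpos hσ h

theorem reducedBilliard_rightUnique {M : ℕ} (hM : M ≠ 0) :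
    Relator.RightUnique (ReducedBilliard M) := by
  rintro z _ _ ⟨_, h1, ρ, hρ, rfl⟩ ⟨_, h2, σ, hσ, rfl⟩
  have hρ0 : ρ ≠ 0 := by simpa using ne_zero_of_pow_eq_one hM hρ
  have h3 : (σ / ρ) ^ M = 1 := by rw [← neg_div_neg_eq, div_pow, hρ, hσ, div_one]
  have h4 := h1.eq_one_of_mul hM h3 (by rwa [← mul_assoc, div_mul_cancel₀ _ hρ0])
  rw [div_eq_one_iff_eq hρ0] at h4
  rw [h4]

/-- The reflection in the axis of the tangent cone at `1`. -/
def axisReflection (z : ℂ) : ℂ := 2 - (starRingEnd ℂ) z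

theorem axisReflection_axisReflection (z : ℂ) : axisReflection (axisReflection z) = z := by
  simp [axisReflection, map_ofNat]

theorem im_conj_one_sub_mul_sub (z b : ℂ) :
    ((starRingEnd ℂ) (1 - z) * (b - z)).im = ((starRingEnd ℂ) (1 - z) * (b - 1)).im := by
  simp only [mul_im, conj_re, conj_im, sub_re, sub_im, one_re, one_im]
  ring

theorem strictlyRight_one_iff (z b : ℂ) :
    StrictlyRight z 1 b ↔ ((starRingEnd ℂ) (1 - z) * (b - 1)).im < 0 := by
  rw [StrictlyRight, im_conj_one_sub_mul_sub]

theorem TangentCone.axisReflection {M : ℕ} {z : ℂ} (h : TangentCone M z) :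
    TangentCone M (axisReflection z) := by
  intro b hb hb1
  have h1 := h ((starRingEnd ℂ) b) (by rw [← map_pow, hb, map_one])
    (by rwa [Ne, map_eq_one_iff _ (starRingEnd ℂ).injective])
  rw [strictlyRight_one_iff] at h1 ⊢
  refine lt_of_eq_of_lt ?_ h1
  simp only [_root_.axisReflection, mul_im, conj_re, conj_im, sub_re, sub_im, one_re, one_im,
    re_ofNat, im_ofNat]
  ring

theorem ReducedBilliard.axisReflection_swap {M : ℕ} (hM : M ≠ 0) {z z' : ℂ}
    (h : ReducedBilliard M z z') :
    ReducedBilliard M (axisReflection z') (axisReflection z) := by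
  obtain ⟨h1, h2, ρ, hρ, rfl⟩ := h
  refine ⟨h2.axisReflection, h1.axisReflection, ρ, hρ, ?_⟩
  have hn : ‖ρ‖ = 1 := by simpa using norm_eq_one_of_pow_eq_one hρ hM
  have h3 : (starRingEnd ℂ) ρ * ρ = 1 := by
    rw [← normSq_eq_conj_mul_self, normSq_eq_norm_sq, hn]; norm_num
  simp only [axisReflection, map_mul, map_sub, map_ofNat]
  linear_combination ((starRingEnd ℂ) z - 2) * h3

theorem reducedBilliard_leftUnique {M : ℕ} (hM : M ≠ 0) :
    Relator.LeftUnique (ReducedBilliard M) := by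
  intro a b c ha hb
  have := reducedBilliard_rightUnique hM (ha.axisReflection_swap hM) (hb.axisReflection_swap hM)
  rw [← axisReflection_axisReflection a, this, axisReflection_axisReflection]

theorem dualBilliard_rightUnique (M : ℕ) : Relator.RightUnique (DualBilliard M) := by
  rintro z _ _ ⟨a, ha, h, rfl⟩ ⟨b, hb, h', rfl⟩
  by_cases hab : b = a
  · rw [hab]
  · exact absurd (h' a ha (Ne.symm hab)) (h b hb hab).asymm

theorem dualBilliard_leftUnique (M : ℕ) : Relator.LeftUnique (DualBilliard M) := by
  rintro x y z ⟨a, ha, h, h1⟩ ⟨b, hb, h', h2⟩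
  by_cases hab : b = a
  · subst hab
    linear_combination h1 - h2
  · have e1 := h b hb hab
    have e2 := h' a ha (Ne.symm hab)
    have hx : x = 2 * a - z := by linear_combination h1
    have hy : y = 2 * b - z := by linear_combination h2
    exfalso
    subst hx hy
    simp only [StrictlyRight, mul_im, mul_re, conj_re, conj_im, sub_re, sub_im, re_ofNat,
      im_ofNat] at e1 e2
    nlinarith

theorem DualBilliard.mul {M : ℕ} (hM : M ≠ 0) {ρ : ℂ} (hρ : ρ ^ M = 1) {z z' : ℂ}
    (h : DualBilliard M z z') : DualBilliard M (ρ * z) (ρ * z') := by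
  obtain ⟨a, ha, h, rfl⟩ := h
  have h0 := ne_zero_of_pow_eq_one hM ha
  have h1 : (ρ * a) ^ M = 1 := by rw [mul_pow, hρ, ha, one_mul]
  refine ⟨ρ * a, h1, ?_, by ring⟩
  have h2 : TangentCone M (a⁻¹ * z) :=
    (tangent_iff_tangentCone hM ha _).1 (by rwa [mul_inv_cancel_left₀ h0])
  have := (tangent_iff_tangentCone hM h1 _).2 h2
  rwa [mul_assoc, mul_inv_cancel_left₀ h0] at this

theorem dualBilliard_mul_of_reduced {M : ℕ} (hM : M ≠ 0) {a y y' ρ : ℂ}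
    (ha : a ^ M = 1) (hy : TangentCone M y) (hρ : (-ρ) ^ M = 1) (hy' : y' = ρ * (y - 2)) :
    DualBilliard M (a * y) (-(a * ρ⁻¹) * y') := by
  refine ⟨a, ha, (tangent_iff_tangentCone hM ha y).2 hy, ?_⟩
  have hρ0 : ρ ≠ 0 := by simpa using ne_zero_of_pow_eq_one hM hρ
  rw [hy']
  field_simp
  ring

theorem reducedBilliard_of_dualBilliard {M : ℕ} (hM : M ≠ 0) {a a' y y' : ℂ} (ha : a ^ M = 1)
    (ha' : a' ^ M = 1) (hy : TangentCone M y) (hy' : TangentCone M y')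
    (h : DualBilliard M (a * y) (a' * y')) : ReducedBilliard M y y' := by
  have h0 := ne_zero_of_pow_eq_one hM ha
  have h0' := ne_zero_of_pow_eq_one hM ha'
  have h1 := dualBilliard_rightUnique M h
    ⟨a, ha, (tangent_iff_tangentCone hM ha y).2 hy, rfl⟩
  refine ⟨hy, hy', -(a * a'⁻¹), ?_, ?_⟩
  · rw [neg_neg, mul_pow, inv_pow, ha, ha', inv_one, one_mul]
  · field_simp
    linear_combination h1

theorem exists_isAperiodicPt_of_hasAcyclicOrbit {M : ℕ} (hM : M ≠ 0)
    (h : HasAcyclicOrbit (ReducedBilliard M)) : ∃ z, IsAperiodicPt M z := by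
  obtain ⟨Y, hs, hp, y₀, hy₀, hc⟩ := h
  have hcone : ∀ y ∈ Y, TangentCone M y := fun y hy => (hs y hy).elim fun _ h => h.2.1
  let Z : Set ℂ := {z | ∃ a y, a ^ M = 1 ∧ y ∈ Y ∧ z = a * y}
  obtain ⟨g, hg0, hgZ, hg⟩ := exists_int_orbit (R := DualBilliard M) (Y := Z) (y₀ := y₀)
    (by
      rintro _ ⟨a, y, ha, hy, rfl⟩
      obtain ⟨y', hy', _, _, ρ, hρ, he⟩ := hs y hy
      refine ⟨_, ⟨-(a * ρ⁻¹), y', ?_, hy', rfl⟩,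
        dualBilliard_mul_of_reduced hM ha (hcone y hy) hρ he⟩
      rw [show -(a * ρ⁻¹) = a * (-ρ)⁻¹ by rw [inv_neg]; ring, mul_pow, inv_pow, hρ, ha,
        inv_one, one_mul])
    (by
      rintro _ ⟨a, y, ha, hy, rfl⟩
      obtain ⟨y', hy', _, _, ρ, hρ, he⟩ := hp y hy
      have hρ0 : ρ ≠ 0 := by simpa using ne_zero_of_pow_eq_one hM hρ
      have h1 : (a * -ρ) ^ M = 1 := by rw [mul_pow, ha, hρ, one_mul]
      refine ⟨_, ⟨a * -ρ, y', h1, hy', rfl⟩, ?_⟩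
      have := dualBilliard_mul_of_reduced hM h1 (hcone y' hy') hρ he
      rwa [show -(a * -ρ * ρ⁻¹) = a by field_simp] at this)
    ⟨1, y₀, one_pow M, hy₀, (one_mul _).symm⟩
  refine ⟨y₀, g, ?_, hg0, fun n => hg n⟩
  have hlift : ∀ z, TransGen (DualBilliard M) y₀ z →
      ∃ a y, a ^ M = 1 ∧ y ∈ Y ∧ z = a * y ∧ TransGen (ReducedBilliard M) y₀ y := by
    intro z hz
    have key : ∀ a y w, a ^ M = 1 → y ∈ Y → DualBilliard M (a * y) w →
        ∃ b y', b ^ M = 1 ∧ y' ∈ Y ∧ w = b * y' ∧ ReducedBilliard M y y' := by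
      intro a y w ha hy hw
      obtain ⟨y', hy', hr⟩ := hs y hy
      obtain ⟨_, _, ρ, hρ, he⟩ := id hr
      refine ⟨a * (-ρ)⁻¹, y', ?_, hy', dualBilliard_rightUnique M hw ?_, hr⟩
      · rw [mul_pow, inv_pow, hρ, ha, inv_one, one_mul]
      · rw [inv_neg, mul_neg]
        exact dualBilliard_mul_of_reduced hM ha (hcone y hy) hρ he
    induction hz with
    | single h =>
      obtain ⟨b, y', hb, hy', rfl, hr⟩ := key 1 y₀ _ (one_pow M) hy₀ (by simpa using h)
      exact ⟨b, y', hb, hy', rfl, .single hr⟩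
    | tail _ h ih =>
      obtain ⟨a, y, ha, hy, rfl, hr⟩ := ih
      obtain ⟨b, y', hb, hy', rfl, hr'⟩ := key a y _ ha hy h
      exact ⟨b, y', hb, hy', rfl, hr.tail hr'⟩
  have hper : ∀ n : ℤ, ∀ p : ℕ, g n ≠ g (n + p + 1) := by
    intro n p heq
    have hall : ∀ k, g k = g (k + p + 1) := by
      intro k
      induction k using Int.inductionOn' (b := n) with
      | zero => exact heq
      | succ k _ ih =>
        refine dualBilliard_rightUnique M (hg k) ?_
        rw [ih, show k + 1 + p + 1 = k + p + 1 + 1 by ring]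
        exact hg _
      | pred k _ ih =>
        have h1 := hg (k - 1)
        have h2 := hg (k - 1 + p + 1)
        rw [sub_add_cancel, ih] at h1
        rw [show k - 1 + p + 1 + 1 = k + p + 1 by ring] at h2
        exact dualBilliard_leftUnique M h1 h2
    have h1 := transGen_orbit hg 0 p
    rw [← hall 0, hg0] at h1
    obtain ⟨a, y, ha, hy, he, hr⟩ := hlift _ h1
    have ha1 := (hcone y hy).eq_one_of_mul hM ha (he ▸ hcone y₀ hy₀)
    rw [ha1, one_mul] at he
    exact hc (he ▸ hr)
  intro n m hnm
  rcases lt_trichotomy n m with h | h | h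
  · obtain ⟨p, rfl⟩ : ∃ p : ℕ, m = n + p + 1 := ⟨(m - n - 1).toNat, by omega⟩
    exact absurd hnm (hper n p)
  · exact h
  · obtain ⟨p, rfl⟩ : ∃ p : ℕ, n = m + p + 1 := ⟨(n - m - 1).toNat, by omega⟩
    exact absurd hnm.symm (hper m p)

theorem exists_reduced_orbit_of_isAperiodicPt {M : ℕ} (hM : M ≠ 0) {z : ℂ}
    (h : IsAperiodicPt M z) : ∃ x : ℤ → ℂ, Function.Injective x ∧
      ∀ n, ReducedBilliard M (x n) (x (n + 1)) := by
  obtain ⟨g, hinj, -, hg⟩ := h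
  have hstep : ∀ n, DualBilliard M (g n) (g (n + 1)) := hg
  choose a ha htan hnext using hg
  have ha0 : ∀ n, a n ≠ 0 := fun n => ne_zero_of_pow_eq_one hM (ha n)
  have hcone : ∀ n, TangentCone M ((a n)⁻¹ * g n) := fun n =>
    (tangent_iff_tangentCone hM (ha n) _).1 (by rw [mul_inv_cancel_left₀ (ha0 n)]; exact htan n)
  refine ⟨fun n => (a n)⁻¹ * g n, ?_, fun n => ?_⟩
  · have key : ∀ (n : ℤ) (p : ℕ), 0 < p → (a n)⁻¹ * g n ≠ (a (n + p))⁻¹ * g (n + p) := by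
      intro n p hp heq
      obtain ⟨ρ, hρ, he⟩ : ∃ ρ : ℂ, ρ ^ M = 1 ∧ g (n + p) = ρ * g n := by
        refine ⟨a (n + p) * (a n)⁻¹, ?_, ?_⟩
        · rw [mul_pow, inv_pow, ha, ha, inv_one, one_mul]
        · rw [mul_assoc, heq, mul_inv_cancel_left₀ (ha0 _)]
      have h1 : ∀ j : ℕ, g (n + p + j) = ρ * g (n + j) := by
        intro j
        induction j with
        | zero => simpa using he
        | succ j ih =>
          have h2 := hstep (n + p + j)
          rw [ih] at h2
          have h3 := dualBilliard_rightUnique M h2 ((hstep (n + j)).mul hM hρ)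
          push_cast
          rw [← add_assoc, ← add_assoc]
          exact h3
      have h2 : ∀ j : ℕ, g (n + j * p) = ρ ^ j * g n := by
        intro j
        induction j with
        | zero => simp
        | succ j ih =>
          have := h1 (j * p)
          push_cast at this ⊢
          rw [show n + (j + 1) * (p : ℤ) = n + p + j * p by ring, this, ih]
          ring
      have h3 := h2 M
      rw [hρ, one_mul] at h3
      have h4 := hinj h3
      have : 0 < (M : ℤ) * p := by positivity
      omega
    intro n m hnm
    rcases lt_trichotomy n m with h | h | h
    · obtain ⟨p, rfl⟩ : ∃ p : ℕ, m = n + p := ⟨(m - n).toNat, by omega⟩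
      exact absurd hnm (key n p (by omega))
    · exact h
    · obtain ⟨p, rfl⟩ : ∃ p : ℕ, n = m + p := ⟨(n - m).toNat, by omega⟩
      exact absurd hnm.symm (key m p (by omega))
  · refine reducedBilliard_of_dualBilliard hM (ha n) (ha (n + 1)) (hcone n) (hcone (n + 1)) ?_
    rw [mul_inv_cancel_left₀ (ha0 _), mul_inv_cancel_left₀ (ha0 _)]
    exact hstep n

/-! ### Projections onto directions -/

/-- The signed length of the projection of `z` onto the direction of argument `ψ`. -/
def dirProj (ψ : ℝ) (z : ℂ) : ℝ := z.re * Real.cos ψ + z.im * Real.sin ψ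

theorem dirProj_exp_mul (ψ α : ℝ) (z : ℂ) : dirProj ψ (exp (α * I) * z) = dirProj (ψ - α) z := by
  simp only [dirProj, mul_re, mul_im, exp_ofReal_mul_I_re, exp_ofReal_mul_I_im, Real.cos_sub,
    Real.sin_sub]
  ring

theorem dirProj_three_directions (α β γ : ℝ) (z : ℂ) :
    dirProj β z * Real.sin (γ - α) =
      dirProj α z * Real.sin (γ - β) + dirProj γ z * Real.sin (β - α) := by
  simp only [dirProj, Real.sin_sub]
  ring

theorem lt_dirProj_of_le {α β γ c : ℝ} {z : ℂ} (hc : 0 < c) (hαβ : α < β) (hβγ : β < γ)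
    (hγα : γ < α + Real.pi) (hα : c ≤ dirProj α z) (hγ : c ≤ dirProj γ z) :
    c < dirProj β z := by
  have h := dirProj_three_directions α β γ z
  have h1 : 0 < Real.sin (γ - β) := Real.sin_pos_of_pos_of_lt_pi (by linarith) (by linarith)
  have h2 : 0 < Real.sin (β - α) := Real.sin_pos_of_pos_of_lt_pi (by linarith) (by linarith)
  have h3 : 0 < Real.sin (γ - α) := Real.sin_pos_of_pos_of_lt_pi (by linarith) (by linarith)
  have h4 : Real.sin (γ - α) < Real.sin (γ - β) + Real.sin (β - α) := by
    have e : γ - α = (γ - β) + (β - α) := by ring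
    have c1 : Real.cos (β - α) < 1 := by
      rw [← Real.cos_zero]
      exact Real.cos_lt_cos_of_nonneg_of_le_pi le_rfl (by linarith) (by linarith)
    have c2 := Real.cos_le_one (γ - β)
    rw [e, Real.sin_add]
    nlinarith
  have h5 := mul_le_mul_of_nonneg_right hα h1.le
  have h6 := mul_le_mul_of_nonneg_right hγ h2.le
  have h7 := mul_lt_mul_of_pos_left h4 hc
  by_contra hlt
  have h8 := mul_le_mul_of_nonneg_right (not_lt.1 hlt) h3.le
  linarith

theorem im_conj_one_sub_mul_exp (ψ : ℝ) (z : ℂ) :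
    ((starRingEnd ℂ) (1 - z) * (exp ((2 * ψ : ℝ) * I) - 1)).im =
      2 * Real.sin ψ * (Real.cos ψ - dirProj ψ z) := by
  simp only [mul_im, conj_re, conj_im, sub_re, sub_im, one_re, one_im, exp_ofReal_mul_I_re,
    exp_ofReal_mul_I_im, Real.cos_two_mul, Real.sin_two_mul, dirProj]
  linear_combination 2 * z.im * Real.sin_sq_add_cos_sq ψ

theorem exists_angle_of_pow_eq_one {M : ℕ} (hM : M ≠ 0) {b : ℂ} (hb : b ^ M = 1) :
    ∃ k < M, b = exp ((2 * (k * (Real.pi / M)) : ℝ) * I) := by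
  have : NeZero M := ⟨hM⟩
  obtain ⟨k, hk, rfl⟩ := (isPrimitiveRoot_exp M hM).eq_pow_of_pow_eq_one hb
  refine ⟨k, hk, ?_⟩
  rw [← exp_nat_mul]
  congr 1
  push_cast
  ring

theorem dirProj_pi_sub (ψ : ℝ) (z : ℂ) :
    dirProj (Real.pi - ψ) z = -dirProj (-ψ) z := by
  simp only [dirProj, Real.cos_pi_sub, Real.sin_pi_sub, Real.cos_neg, Real.sin_neg]
  ring

theorem dirProj_sub_one (ψ : ℝ) (z : ℂ) : dirProj ψ (z - 1) = dirProj ψ z - Real.cos ψ := by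
  simp only [dirProj, sub_re, sub_im, one_re, one_im]
  ring

theorem pi_div_bounds {M k : ℕ} (hM : 3 ≤ M) (hk : 1 ≤ k) (hkM : k < M) :
    0 < Real.pi / M ∧ Real.pi / M ≤ k * (Real.pi / M) ∧
      k * (Real.pi / M) ≤ Real.pi - Real.pi / M ∧ Real.pi / M < Real.pi - Real.pi / M := by
  have hM' : (3 : ℝ) ≤ M := by exact_mod_cast hM
  have hk' : (1 : ℝ) ≤ k := by exact_mod_cast hk
  have hkM' : (k : ℝ) + 1 ≤ M := by exact_mod_cast hkM
  have h0 : 0 < Real.pi / M := div_pos Real.pi_pos (by linarith)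
  have hpi : M * (Real.pi / M) = Real.pi := by field_simp
  refine ⟨h0, by nlinarith, by nlinarith, by nlinarith⟩

/-- The closed version of `tangentCone_iff`. -/
theorem im_nonpos_of_dirProj_le {M : ℕ} (hM : 3 ≤ M) {z : ℂ}
    (h₁ : dirProj (-(Real.pi / M)) z ≤ Real.cos (Real.pi / M))
    (h₂ : Real.cos (Real.pi / M) ≤ dirProj (Real.pi / M) z) (b : ℂ) (hb : b ^ M = 1) :
    ((starRingEnd ℂ) (1 - z) * (b - z)).im ≤ 0 := by
  obtain ⟨k, hk, rfl⟩ := exists_angle_of_pow_eq_one (by omega) hb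
  rw [im_conj_one_sub_mul_sub, im_conj_one_sub_mul_exp]
  rcases Nat.eq_zero_or_pos k with rfl | hk0
  · simp
  obtain ⟨h0, h3, h4, h5⟩ := pi_div_bounds hM hk0 hk
  have h := dirProj_three_directions (Real.pi / M) (k * (Real.pi / M)) (Real.pi - Real.pi / M)
    (z - 1)
  have e1 : 0 ≤ dirProj (Real.pi / M) (z - 1) := by rw [dirProj_sub_one]; linarith
  have e2 : 0 ≤ dirProj (Real.pi - Real.pi / M) (z - 1) := by
    rw [dirProj_sub_one, dirProj_pi_sub, Real.cos_pi_sub]; linarith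
  have s1 : 0 < Real.sin (Real.pi - Real.pi / M - Real.pi / M) :=
    Real.sin_pos_of_pos_of_lt_pi (by linarith) (by linarith)
  have s2 : 0 ≤ Real.sin (Real.pi - Real.pi / M - k * (Real.pi / M)) :=
    Real.sin_nonneg_of_nonneg_of_le_pi (by linarith) (by linarith)
  have s3 : 0 ≤ Real.sin (k * (Real.pi / M) - Real.pi / M) :=
    Real.sin_nonneg_of_nonneg_of_le_pi (by linarith) (by linarith)
  have s4 : 0 ≤ Real.sin (k * (Real.pi / M)) :=
    Real.sin_nonneg_of_nonneg_of_le_pi (by linarith) (by linarith)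
  have h6 : 0 ≤ dirProj (k * (Real.pi / M)) (z - 1) := by
    refine nonneg_of_mul_nonneg_left ?_ s1
    rw [h]; positivity
  rw [dirProj_sub_one] at h6
  exact mul_nonpos_of_nonneg_of_nonpos (by positivity) (by linarith)

/-- The tangent cone is cut out by the two sides of the polygon at the vertex `1`. -/
theorem tangentCone_iff {M : ℕ} (hM : 3 ≤ M) (z : ℂ) :
    TangentCone M z ↔ dirProj (-(Real.pi / M)) z < Real.cos (Real.pi / M) ∧
      Real.cos (Real.pi / M) < dirProj (Real.pi / M) z := by
  have hvert : ∀ k : ℕ, 1 ≤ k → k < M →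
      exp ((2 * (k * (Real.pi / M)) : ℝ) * I) ^ M = 1 ∧
      exp ((2 * (k * (Real.pi / M)) : ℝ) * I) ≠ 1 := by
    intro k hk hkM
    have hp := isPrimitiveRoot_exp M (by omega)
    have e : exp ((2 * (k * (Real.pi / M)) : ℝ) * I) = exp (2 * Real.pi * I / M) ^ k := by
      rw [← exp_nat_mul]
      congr 1
      push_cast
      ring
    rw [e]
    exact ⟨by rw [← pow_mul, mul_comm k, pow_mul, hp.pow_eq_one, one_pow],
      hp.pow_ne_one_of_pos_of_lt (by omega) hkM⟩
  have hside : ∀ k : ℕ, 1 ≤ k → k < M →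
      (StrictlyRight z 1 (exp ((2 * (k * (Real.pi / M)) : ℝ) * I)) ↔
        0 < dirProj (k * (Real.pi / M)) (z - 1)) := by
    intro k hk hkM
    obtain ⟨h0, h3, h4, h5⟩ := pi_div_bounds hM hk hkM
    have hs : 0 < Real.sin (k * (Real.pi / M)) :=
      Real.sin_pos_of_pos_of_lt_pi (by linarith) (by linarith)
    rw [strictlyRight_one_iff, im_conj_one_sub_mul_exp, dirProj_sub_one]
    constructor
    · intro h
      by_contra hn
      have : 0 ≤ 2 * Real.sin (k * (Real.pi / M)) *
        (Real.cos (k * (Real.pi / M)) - dirProj (k * (Real.pi / M)) z) :=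
        mul_nonneg (by positivity) (by linarith)
      linarith
    · intro h
      exact mul_neg_of_pos_of_neg (by positivity) (by linarith)
  have elast : ((M - 1 : ℕ) : ℝ) * (Real.pi / M) = Real.pi - Real.pi / M := by
    have : (M : ℝ) ≠ 0 := by positivity
    rw [Nat.cast_sub (by omega)]
    field_simp
    norm_num
  constructor
  · intro h
    have h1 := (hside 1 le_rfl (by omega)).1
      (h _ (hvert 1 le_rfl (by omega)).1 (hvert 1 le_rfl (by omega)).2)
    have h2 := (hside (M - 1) (by omega) (by omega)).1
      (h _ (hvert (M - 1) (by omega) (by omega)).1 (hvert (M - 1) (by omega) (by omega)).2)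
    rw [elast, dirProj_sub_one, dirProj_pi_sub, Real.cos_pi_sub] at h2
    rw [Nat.cast_one, one_mul, dirProj_sub_one] at h1
    exact ⟨by linarith, by linarith⟩
  · rintro ⟨h1, h2⟩ b hb hb1
    obtain ⟨k, hk, rfl⟩ := exists_angle_of_pow_eq_one (by omega) hb
    have hk0 : 1 ≤ k := by
      rcases Nat.eq_zero_or_pos k with rfl | h
      · simp at hb1
      · exact h
    rw [hside k hk0 hk]
    obtain ⟨h0, h3, h4, h5⟩ := pi_div_bounds hM hk0 hk
    have h := dirProj_three_directions (Real.pi / M) (k * (Real.pi / M))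
      (Real.pi - Real.pi / M) (z - 1)
    have e1 : 0 < dirProj (Real.pi / M) (z - 1) := by rw [dirProj_sub_one]; linarith
    have e2 : 0 < dirProj (Real.pi - Real.pi / M) (z - 1) := by
      rw [dirProj_sub_one, dirProj_pi_sub, Real.cos_pi_sub]; linarith
    have s1 : 0 < Real.sin (Real.pi - Real.pi / M - Real.pi / M) :=
      Real.sin_pos_of_pos_of_lt_pi (by linarith) (by linarith)
    have s3 : 0 ≤ Real.sin (k * (Real.pi / M) - Real.pi / M) :=
      Real.sin_nonneg_of_nonneg_of_le_pi (by linarith) (by linarith)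
    refine pos_of_mul_pos_left ?_ s1.le
    rw [h]
    rcases h4.lt_or_eq with h4 | h4
    · have s2 : 0 < Real.sin (Real.pi - Real.pi / M - k * (Real.pi / M)) :=
        Real.sin_pos_of_pos_of_lt_pi (by linarith) (by linarith)
      positivity
    · rw [h4, sub_self, Real.sin_zero, mul_zero, zero_add]
      positivity

/-! ### The sides of the regular `N`-gon and of the regular `2N`-gon -/

/-- The projection onto the direction of argument `j * π / (2N)`. The directions with `j` odd
are the normals of the sides of the regular `2N`-gon, those with `j ≡ 2` modulo `4` are the
normals of the sides of the regular `N`-gon. -/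
def sideProj (N : ℕ) (j : ℤ) (z : ℂ) : ℝ := dirProj (j * (Real.pi / (2 * N))) z

/-- The primitive `2N`-th root of unity of least positive argument. -/
def gonRoot (N : ℕ) : ℂ := exp ((Real.pi / N : ℝ) * I)

theorem sideProj_add_two_mul {N : ℕ} (hN : 0 < N) (j : ℤ) (z : ℂ) :
    sideProj N (j + 2 * N) z = -sideProj N j z := by
  have h : ((j + 2 * N : ℤ) : ℝ) * (Real.pi / (2 * N)) = j * (Real.pi / (2 * N)) + Real.pi := by
    push_cast
    field_simp
  simp only [sideProj, dirProj, h, Real.cos_add_pi, Real.sin_add_pi]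
  ring

theorem sideProj_sub_two_mul {N : ℕ} (hN : 0 < N) (j : ℤ) (z : ℂ) :
    sideProj N (j - 2 * N) z = -sideProj N j z := by
  have := sideProj_add_two_mul hN (j - 2 * N) z
  rw [sub_add_cancel] at this
  linarith

theorem sideProj_add_four_mul {N : ℕ} (hN : 0 < N) (j : ℤ) (z : ℂ) :
    sideProj N (j + 4 * N) z = sideProj N j z := by
  rw [show j + 4 * N = j + 2 * N + 2 * N by ring, sideProj_add_two_mul hN,
    sideProj_add_two_mul hN, neg_neg]

theorem lt_sideProj_of_le {N : ℕ} (hN : 0 < N) {c : ℝ} (hc : 0 < c) {z : ℂ} {i j k : ℤ}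
    (hij : i < j) (hjk : j < k) (hki : k < i + 2 * N) (hi : c ≤ sideProj N i z)
    (hk : c ≤ sideProj N k z) : c < sideProj N j z := by
  have hN' : (0 : ℝ) < N := by exact_mod_cast hN
  have hδ : 0 < Real.pi / (2 * N) := div_pos Real.pi_pos (by linarith)
  refine lt_dirProj_of_le hc (mul_lt_mul_of_pos_right (by exact_mod_cast hij) hδ)
    (mul_lt_mul_of_pos_right (by exact_mod_cast hjk) hδ) ?_ hi hk
  have h : (k : ℝ) < i + 2 * N := by exact_mod_cast hki
  have := mul_lt_mul_of_pos_right h hδ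
  rwa [add_mul, show 2 * (N : ℝ) * (Real.pi / (2 * N)) = Real.pi by field_simp] at this

theorem sideProj_zpow_mul (N : ℕ) (i j : ℤ) (z : ℂ) :
    sideProj N j (gonRoot N ^ (-i) * z) = sideProj N (j + 2 * i) z := by
  have h : gonRoot N ^ (-i) = exp ((-i * (Real.pi / N) : ℝ) * I) := by
    rw [gonRoot, ← exp_int_mul]
    congr 1
    push_cast
    ring
  rw [h, sideProj, dirProj_exp_mul, sideProj]
  congr 1
  rcases Nat.eq_zero_or_pos N with rfl | hN
  · simp
  · push_cast
    field_simp
    ring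

theorem sideProj_sub_two (N : ℕ) (j : ℤ) (z : ℂ) :
    sideProj N j (z - 2) = sideProj N j z - 2 * Real.cos (j * (Real.pi / (2 * N))) := by
  simp only [sideProj, dirProj, sub_re, sub_im, re_ofNat, im_ofNat]
  ring

theorem cos_pi_div_eq (N : ℕ) :
    Real.cos (Real.pi / N) = 2 * Real.cos (Real.pi / (2 * N)) ^ 2 - 1 := by
  rw [← Real.cos_two_mul]
  congr 1
  rcases Nat.eq_zero_or_pos N with rfl | hN
  · simp
  · field_simp

theorem pi_div_two_mul_bounds {N : ℕ} (hN : 3 ≤ N) :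
    0 < Real.pi / (2 * N) ∧ 2 * (Real.pi / (2 * N)) < Real.pi / 2 := by
  have hN' : (3 : ℝ) ≤ N := by exact_mod_cast hN
  have h0 : 0 < Real.pi / (2 * N) := div_pos Real.pi_pos (by linarith)
  have hpi : 2 * (N : ℝ) * (Real.pi / (2 * N)) = Real.pi := by field_simp
  exact ⟨h0, by nlinarith⟩

theorem cos_pi_div_two_mul_pos {N : ℕ} (hN : 3 ≤ N) : 0 < Real.cos (Real.pi / (2 * N)) := by
  have := pi_div_two_mul_bounds hN
  exact Real.cos_pos_of_mem_Ioo ⟨by linarith, by linarith⟩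

theorem sin_pi_div_two_mul_pos {N : ℕ} (hN : 3 ≤ N) : 0 < Real.sin (Real.pi / (2 * N)) := by
  have := pi_div_two_mul_bounds hN
  exact Real.sin_pos_of_pos_of_lt_pi (by linarith) (by linarith)

theorem cos_pi_div_pos {N : ℕ} (hN : 3 ≤ N) : 0 < Real.cos (Real.pi / N) := by
  have := pi_div_two_mul_bounds hN
  rw [show Real.pi / N = 2 * (Real.pi / (2 * N)) by field_simp]
  exact Real.cos_pos_of_mem_Ioo ⟨by linarith, by linarith⟩

theorem tangentCone_iff_sideProj {N : ℕ} (hN : 3 ≤ N) (z : ℂ) :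
    TangentCone N z ↔ sideProj N (-2) z < Real.cos (Real.pi / N) ∧
      Real.cos (Real.pi / N) < sideProj N 2 z := by
  rw [tangentCone_iff hN, sideProj, sideProj,
    show ((2 : ℤ) : ℝ) * (Real.pi / (2 * N)) = Real.pi / N by push_cast; field_simp,
    show ((-2 : ℤ) : ℝ) * (Real.pi / (2 * N)) = -(Real.pi / N) by push_cast; field_simp]

theorem tangentCone_two_mul_iff_sideProj {N : ℕ} (hN : 3 ≤ N) (z : ℂ) :
    TangentCone (2 * N) z ↔ sideProj N (-1) z < Real.cos (Real.pi / (2 * N)) ∧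
      Real.cos (Real.pi / (2 * N)) < sideProj N 1 z := by
  rw [tangentCone_iff (by omega), sideProj, sideProj]
  push_cast
  rw [neg_mul, one_mul]

theorem gonRoot_ne_zero (N : ℕ) : gonRoot N ≠ 0 := exp_ne_zero _

theorem isPrimitiveRoot_gonRoot {N : ℕ} (hN : 0 < N) : IsPrimitiveRoot (gonRoot N) (2 * N) := by
  have h := isPrimitiveRoot_exp (2 * N) (by omega)
  have hN' : (N : ℂ) ≠ 0 := by exact_mod_cast hN.ne'
  convert h using 1
  rw [gonRoot]
  congr 1
  push_cast
  field_simp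

theorem gonRoot_pow {N : ℕ} (hN : 0 < N) : gonRoot N ^ N = -1 := by
  have hN' : (N : ℂ) ≠ 0 := by exact_mod_cast hN.ne'
  rw [gonRoot, ← exp_nat_mul, ← exp_pi_mul_I]
  congr 1
  push_cast
  field_simp

theorem gonRoot_ne_one {N : ℕ} (hN : 0 < N) : gonRoot N ≠ 1 := by
  intro h
  have := gonRoot_pow hN
  rw [h, one_pow] at this
  norm_num at this

theorem gonRoot_ne_neg_one {N : ℕ} (hN : 2 ≤ N) : gonRoot N ≠ -1 := by
  intro h
  refine (isPrimitiveRoot_gonRoot (N := N) (by omega)).pow_ne_one_of_pos_of_lt (l := 2) two_ne_zero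
    (by omega) ?_
  rw [h]
  norm_num

theorem exists_gonRoot_pow {N : ℕ} (hN : 0 < N) {b : ℂ} (hb : b ^ (2 * N) = 1) :
    ∃ k < 2 * N, b = gonRoot N ^ k := by
  have : NeZero (2 * N) := ⟨by omega⟩
  obtain ⟨k, hk, rfl⟩ := (isPrimitiveRoot_gonRoot hN).eq_pow_of_pow_eq_one hb
  exact ⟨k, hk, rfl⟩

theorem exists_gonRoot_sq_pow {N : ℕ} (hN : 0 < N) {b : ℂ} (hb : b ^ N = 1) :
    ∃ k < N, b = gonRoot N ^ (2 * k) := by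
  have : NeZero N := ⟨by omega⟩
  obtain ⟨k, hk, rfl⟩ := ((isPrimitiveRoot_gonRoot hN).pow (by omega) (a := 2)
    rfl).eq_pow_of_pow_eq_one hb
  exact ⟨k, hk, by rw [pow_mul]⟩

theorem neg_two_div_exp_sub_one {α : ℝ} (hα : Real.sin α ≠ 0) :
    -2 / (exp ((2 * α : ℝ) * I) - 1) = 1 + (Real.cos α / Real.sin α : ℝ) * I := by
  have hs : (Real.sin α : ℂ) ≠ 0 := by exact_mod_cast hα
  have e : exp ((2 * α : ℝ) * I) = (Real.cos α + Real.sin α * I) ^ 2 := by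
    rw [ofReal_cos, ofReal_sin, ← exp_mul_I, ← exp_nat_mul]
    congr 1
    push_cast
    ring
  have h1 : (Real.sin α : ℂ) ^ 2 + (Real.cos α : ℂ) ^ 2 = 1 := by
    exact_mod_cast Real.sin_sq_add_cos_sq α
  set c : ℂ := (Real.cos α : ℂ)
  set s : ℂ := (Real.sin α : ℂ)
  have key : (1 + c / s * I) * ((c + s * I) ^ 2 - 1) = -2 := by
    have : (s + c * I) * ((c + s * I) ^ 2 - 1) = -2 * s := by
      linear_combination (c * I - s) * h1 +
        (c ^ 2 * s * 2 + s ^ 3 + c * s ^ 2 * I) * I_sq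
    field_simp
    linear_combination this
  have hne : (c + s * I) ^ 2 - 1 ≠ 0 := by
    intro h0
    rw [h0, mul_zero] at key
    norm_num at key
  rw [e, div_eq_iff hne, ofReal_div]
  exact key.symm

theorem dirProj_one_add_cot (ψ α : ℝ) :
    dirProj ψ (1 + (Real.cos α / Real.sin α : ℝ) * I) =
      Real.cos ψ + Real.cos α / Real.sin α * Real.sin ψ := by
  simp only [dirProj, add_re, add_im, one_re, one_im, re_ofReal_mul, im_ofReal_mul, I_re, I_im]
  ring

theorem dirProj_add (ψ : ℝ) (z w : ℂ) : dirProj ψ (z + w) = dirProj ψ z + dirProj ψ w := by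
  simp only [dirProj, add_re, add_im]
  ring

theorem dirProj_ofReal_mul (ψ r : ℝ) (z : ℂ) : dirProj ψ (r * z) = r * dirProj ψ z := by
  simp only [dirProj, re_ofReal_mul, im_ofReal_mul]
  ring

theorem one_add_inv_gonRoot (N : ℕ) :
    1 + (gonRoot N)⁻¹ =
      (2 * Real.cos (Real.pi / (2 * N)) : ℝ) * exp ((-(Real.pi / (2 * N)) : ℝ) * I) := by
  have e : (gonRoot N)⁻¹ = exp ((-(Real.pi / (2 * N)) : ℝ) * I) ^ 2 := by
    rw [gonRoot, ← exp_neg, ← exp_nat_mul]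
    congr 1
    rcases Nat.eq_zero_or_pos N with rfl | hN
    · simp
    · have hN' : (N : ℂ) ≠ 0 := by exact_mod_cast hN.ne'
      push_cast
      field_simp
  have h1 : exp ((-(Real.pi / (2 * N)) : ℝ) * I) * exp ((Real.pi / (2 * N) : ℝ) * I) = 1 := by
    rw [← exp_add, ← add_mul, ← ofReal_add, neg_add_cancel, ofReal_zero, zero_mul, exp_zero]
  rw [e, ofReal_mul, ofReal_cos, Complex.cos]
  push_cast at h1 ⊢
  rw [← h1, neg_mul]
  ring

theorem two_mul_cos_mul_cot {α : ℝ} (hα : Real.sin α ≠ 0) :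
    Real.cos α / Real.sin α * Real.sin (2 * α) = 2 * Real.cos α ^ 2 := by
  rw [Real.sin_two_mul]
  field_simp

/-! ### The two similarities -/

/-- The similarity under which the reduced map of the `2N`-gon is a first return map of the
reduced map of the `N`-gon. -/
def outerSimilarity (N : ℕ) (z : ℂ) : ℂ := (1 + (gonRoot N)⁻¹) * z + -2 / (gonRoot N - 1)

/-- The similarity under which the inner part of the reduced map of the `N`-gon is a first
return map of the reduced map of the `2N`-gon. -/
def innerSimilarity (N : ℕ) (z : ℂ) : ℂ := (1 + (gonRoot N)⁻¹)⁻¹ * z + -2 / (gonRoot N ^ 2 - 1)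

theorem sideProj_outerSimilarity {N : ℕ} (hN : 3 ≤ N) (j : ℤ) (z : ℂ) :
    sideProj N j (outerSimilarity N z) =
      2 * Real.cos (Real.pi / (2 * N)) * sideProj N (j + 1) z +
        (Real.cos (j * (Real.pi / (2 * N))) + Real.cos (Real.pi / (2 * N)) /
          Real.sin (Real.pi / (2 * N)) * Real.sin (j * (Real.pi / (2 * N)))) := by
  have hg : gonRoot N = exp ((2 * (Real.pi / (2 * N)) : ℝ) * I) := by
    rw [gonRoot]
    congr 2
    push_cast
    field_simp
  rw [outerSimilarity, one_add_inv_gonRoot, hg,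
    neg_two_div_exp_sub_one (sin_pi_div_two_mul_pos hN).ne', sideProj, dirProj_add,
    dirProj_one_add_cot, mul_assoc, dirProj_ofReal_mul, dirProj_exp_mul, sideProj]
  congr 4
  push_cast
  ring

theorem sideProj_neg_two_outerSimilarity {N : ℕ} (hN : 3 ≤ N) (z : ℂ) :
    sideProj N (-2) (outerSimilarity N z) =
      2 * Real.cos (Real.pi / (2 * N)) * sideProj N (-1) z - 1 := by
  have h := two_mul_cos_mul_cot (sin_pi_div_two_mul_pos hN).ne'
  rw [sideProj_outerSimilarity hN]
  push_cast
  rw [neg_mul, Real.cos_neg, Real.sin_neg, Real.cos_two_mul]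
  norm_num
  linarith

theorem sideProj_two_outerSimilarity {N : ℕ} (hN : 3 ≤ N) (z : ℂ) :
    sideProj N 2 (outerSimilarity N z) =
      2 * Real.cos (Real.pi / (2 * N)) * sideProj N 3 z +
        4 * Real.cos (Real.pi / (2 * N)) ^ 2 - 1 := by
  have h := two_mul_cos_mul_cot (sin_pi_div_two_mul_pos hN).ne'
  rw [sideProj_outerSimilarity hN]
  push_cast
  rw [Real.cos_two_mul]
  linarith

theorem tangentCone_outerSimilarity_iff {N : ℕ} (hN : 3 ≤ N) (z : ℂ) :
    TangentCone N (outerSimilarity N z) ↔ sideProj N (-1) z < Real.cos (Real.pi / (2 * N)) ∧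
      -Real.cos (Real.pi / (2 * N)) < sideProj N 3 z := by
  rw [tangentCone_iff_sideProj hN, sideProj_neg_two_outerSimilarity hN,
    sideProj_two_outerSimilarity hN, cos_pi_div_eq]
  have hc := cos_pi_div_two_mul_pos hN
  constructor
  · rintro ⟨h1, h2⟩
    constructor <;> nlinarith
  · rintro ⟨h1, h2⟩
    constructor <;> nlinarith

theorem tangentCone_two_mul_innerSimilarity_iff {N : ℕ} (hN : 3 ≤ N) (z : ℂ) :
    TangentCone (2 * N) (innerSimilarity N z) ↔ sideProj N (-2) z < Real.cos (Real.pi / N) ∧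
      -Real.cos (Real.pi / N) < sideProj N 0 z := by
  have hc := cos_pi_div_two_mul_pos hN
  have hs := sin_pi_div_two_mul_pos hN
  have hb := pi_div_two_mul_bounds hN
  have hs2 : 0 < Real.sin (2 * (Real.pi / (2 * N))) :=
    Real.sin_pos_of_pos_of_lt_pi (by linarith) (by linarith)
  have hg : gonRoot N ^ 2 = exp ((2 * (2 * (Real.pi / (2 * N))) : ℝ) * I) := by
    rw [gonRoot, ← exp_nat_mul]
    congr 1
    push_cast
    field_simp
  have hinv : (1 + (gonRoot N)⁻¹)⁻¹ =
      (1 / (2 * Real.cos (Real.pi / (2 * N))) : ℝ) * exp ((Real.pi / (2 * N) : ℝ) * I) := by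
    rw [one_add_inv_gonRoot, mul_inv, ← exp_neg, ofReal_neg, neg_mul, neg_neg, ← ofReal_inv,
      one_div]
  have hproj : ∀ j : ℤ, sideProj N j (innerSimilarity N z) =
      1 / (2 * Real.cos (Real.pi / (2 * N))) * sideProj N (j - 1) z +
        (Real.cos (j * (Real.pi / (2 * N))) + Real.cos (2 * (Real.pi / (2 * N))) /
          Real.sin (2 * (Real.pi / (2 * N))) * Real.sin (j * (Real.pi / (2 * N)))) := by
    intro j
    rw [innerSimilarity, hinv, hg, neg_two_div_exp_sub_one hs2.ne', sideProj, dirProj_add,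
      dirProj_one_add_cot, mul_assoc, dirProj_ofReal_mul, dirProj_exp_mul, sideProj]
    congr 4
    push_cast
    ring
  have hcot : Real.cos (2 * (Real.pi / (2 * N))) / Real.sin (2 * (Real.pi / (2 * N))) *
      Real.sin (Real.pi / (2 * N)) = (2 * Real.cos (Real.pi / (2 * N)) ^ 2 - 1) /
        (2 * Real.cos (Real.pi / (2 * N))) := by
    rw [Real.sin_two_mul, Real.cos_two_mul]
    field_simp
  rw [tangentCone_two_mul_iff_sideProj hN, hproj, hproj, cos_pi_div_eq]
  push_cast
  rw [neg_mul, one_mul, Real.cos_neg, Real.sin_neg, mul_neg, hcot]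
  norm_num
  set c := Real.cos (Real.pi / (2 * N))
  have e1 : c⁻¹ * (1 / 2) * sideProj N (-2) z + (c + -((2 * c ^ 2 - 1) / (2 * c))) =
      (sideProj N (-2) z + 1) / (2 * c) := by
    field_simp
    ring
  have e2 : c⁻¹ * (1 / 2) * sideProj N 0 z + (c + (2 * c ^ 2 - 1) / (2 * c)) =
      (sideProj N 0 z + (4 * c ^ 2 - 1)) / (2 * c) := by
    field_simp
    ring
  rw [e1, e2, div_lt_iff₀ (by positivity), lt_div_iff₀ (by positivity)]
  constructor
  · rintro ⟨h1, h2⟩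
    constructor <;> nlinarith
  · rintro ⟨h1, h2⟩
    constructor <;> nlinarith

theorem one_add_inv_gonRoot_ne_zero {N : ℕ} (hN : 2 ≤ N) : 1 + (gonRoot N)⁻¹ ≠ 0 := by
  intro h0
  refine gonRoot_ne_neg_one hN ?_
  have := gonRoot_ne_zero N
  field_simp at h0
  linear_combination h0

theorem outerSimilarity_injective {N : ℕ} (hN : 2 ≤ N) :
    Function.Injective (outerSimilarity N) := by
  intro z w h
  have h1 := one_add_inv_gonRoot_ne_zero hN
  simpa [outerSimilarity, h1] using h

theorem innerSimilarity_injective {N : ℕ} (hN : 2 ≤ N) :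
    Function.Injective (innerSimilarity N) := by
  intro z w h
  have h1 := one_add_inv_gonRoot_ne_zero hN
  simpa [innerSimilarity, h1] using h

/-! ### Lifting the reduced map of the `2N`-gon -/

theorem gonRoot_mul_outerSimilarity_sub {N : ℕ} (hN : 0 < N) (x : ℂ) :
    gonRoot N * (outerSimilarity N x - 2) = outerSimilarity N (gonRoot N * (x - 2)) := by
  have h0 := gonRoot_ne_zero N
  have h1 := sub_ne_zero.2 (gonRoot_ne_one hN)
  simp only [outerSimilarity]
  field_simp
  ring

theorem inv_gonRoot_mul_outerSimilarity_sub {N : ℕ} (hN : 0 < N) (x : ℂ) :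
    (gonRoot N)⁻¹ * (outerSimilarity N x - 2) = outerSimilarity N ((gonRoot N)⁻¹ * x) := by
  have h0 := gonRoot_ne_zero N
  have h1 := sub_ne_zero.2 (gonRoot_ne_one hN)
  simp only [outerSimilarity]
  field_simp
  ring

theorem outerSimilarity_zpow_succ_mul {N : ℕ} (hN : 0 < N) (i : ℤ) (u : ℂ) :
    outerSimilarity N (gonRoot N ^ (-(i + 1)) * u) =
      (gonRoot N)⁻¹ * (outerSimilarity N (gonRoot N ^ (-i) * u) - 2) := by
  rw [inv_gonRoot_mul_outerSimilarity_sub hN, neg_add, zpow_add₀ (gonRoot_ne_zero N), zpow_neg_one]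
  congr 1
  ring

theorem neg_gonRoot_pow {N : ℕ} (hodd : Odd N) : (-gonRoot N) ^ N = 1 := by
  rw [hodd.neg_pow, gonRoot_pow hodd.pos, neg_neg]

theorem neg_inv_gonRoot_pow {N : ℕ} (hodd : Odd N) : (-(gonRoot N)⁻¹) ^ N = 1 := by
  rw [← inv_neg, inv_pow, neg_gonRoot_pow hodd, inv_one]

theorem TangentCone.sideProj_sub_two {N : ℕ} (hN : 3 ≤ N) {x : ℂ} (hx : TangentCone (2 * N) x) :
    Real.cos (Real.pi / (2 * N)) < sideProj N (2 * N - 1) (x - 2) ∧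
      sideProj N (2 * N + 1) (x - 2) < Real.cos (Real.pi / (2 * N)) := by
  rw [tangentCone_two_mul_iff_sideProj hN] at hx
  have h1 := sideProj_add_two_mul (by omega : 0 < N) (-1) (x - 2)
  have h2 := sideProj_add_two_mul (by omega : 0 < N) 1 (x - 2)
  rw [show (2 * N - 1 : ℤ) = -1 + 2 * N by ring, show (2 * N + 1 : ℤ) = 1 + 2 * N by ring, h1, h2,
    _root_.sideProj_sub_two, _root_.sideProj_sub_two]
  push_cast
  rw [neg_mul, one_mul, Real.cos_neg]
  constructor <;> linarith

theorem tangentCone_outerSimilarity {N : ℕ} (hN : 3 ≤ N) {x : ℂ}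
    (hx : TangentCone (2 * N) x) : TangentCone N (outerSimilarity N x) := by
  rw [tangentCone_two_mul_iff_sideProj hN] at hx
  rw [tangentCone_outerSimilarity_iff hN]
  refine ⟨hx.1, ?_⟩
  by_contra! h
  have h3 := sideProj_sub_two_mul (by omega : 0 < N) 3 x
  have := lt_sideProj_of_le (by omega) (cos_pi_div_two_mul_pos hN) (i := 3 - 2 * N) (j := -1)
    (k := 1) (z := x) (by omega) (by omega) (by omega) (by linarith) hx.2.le
  linarith [hx.1]

/-- If the sides `2N - 1` and `2N + 1` of the `2N`-gon separate the point `u` from the polygon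
and contain it respectively, then `u` lies on the inner side of all following sides. -/
theorem sideProj_lt_of_lt {N : ℕ} {c : ℝ} (hc : 0 < c) {u : ℂ}
    (h₁ : c < sideProj N (2 * N - 1) u) (h₂ : sideProj N (2 * N + 1) u < c) {j : ℤ}
    (hj : 2 * N + 1 ≤ j) (hj' : j < 4 * N - 1) : sideProj N j u < c := by
  rcases hj.eq_or_lt with rfl | hj
  · exact h₂
  · by_contra! h
    have := lt_sideProj_of_le (by omega) hc (i := 2 * N - 1) (j := 2 * N + 1) (k := j)
      (by omega) hj (by omega) h₁.le h
    linarith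

theorem neg_lt_sideProj_of_lt {N : ℕ} (hN : 3 ≤ N) {c : ℝ} (hc : 0 < c) {u : ℂ}
    (h₁ : c < sideProj N (2 * N - 1) u) (h₂ : sideProj N (2 * N + 1) u < c) {j : ℤ}
    (hj : 1 ≤ j) (hj' : j ≤ 2 * N - 1) : -c < sideProj N j u := by
  rcases hj'.eq_or_lt with rfl | hj'
  · linarith
  · have h3 := sideProj_add_two_mul (by omega : 0 < N) j u
    have := sideProj_lt_of_lt hc h₁ h₂ (j := j + 2 * N) (by omega) (by omega)
    linarith

theorem tangentCone_outerSimilarity_zpow_mul {N : ℕ} (hN : 3 ≤ N) {u : ℂ}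
    (h₁ : Real.cos (Real.pi / (2 * N)) < sideProj N (2 * N - 1) u)
    (h₂ : sideProj N (2 * N + 1) u < Real.cos (Real.pi / (2 * N))) {k : ℤ} (hk : k < N)
    (h : ∀ j : ℤ, 0 ≤ j → j < k → sideProj N (2 * j + 1) u < Real.cos (Real.pi / (2 * N)))
    {i : ℤ} (hi : -1 ≤ i) (hik : i ≤ k) :
    TangentCone N (outerSimilarity N (gonRoot N ^ (-i) * u)) := by
  have hN0 : 0 < N := by omega
  have hc := cos_pi_div_two_mul_pos hN
  rw [tangentCone_outerSimilarity_iff hN, sideProj_zpow_mul, sideProj_zpow_mul]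
  constructor
  · obtain rfl | rfl | hi : i = -1 ∨ i = 0 ∨ 1 ≤ i := by omega
    · have h3 := sideProj_add_four_mul hN0 (-1 + 2 * -1) u
      rw [← h3]
      exact sideProj_lt_of_lt hc h₁ h₂ (by omega) (by omega)
    · have h3 := sideProj_add_two_mul hN0 (-1) u
      rw [show (-1 + 2 * N : ℤ) = 2 * N - 1 by ring] at h3
      rw [mul_zero, add_zero]
      linarith
    · have h3 := h (i - 1) (by omega) (by omega)
      rwa [show (2 * (i - 1) + 1 : ℤ) = -1 + 2 * i by ring] at h3
  · obtain hi' | rfl : i ≤ N - 2 ∨ i = N - 1 := by omega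
    · exact neg_lt_sideProj_of_lt hN hc h₁ h₂ (by omega) (by omega)
    · have h3 := sideProj_add_two_mul hN0 1 u
      have h4 := h 0 le_rfl (by omega)
      rw [mul_zero, zero_add] at h4
      rw [show (3 + 2 * (N - 1) : ℤ) = 1 + 2 * N by ring]
      linarith

theorem reducedBilliard_outerSimilarity {N : ℕ} (hN : 3 ≤ N) (hodd : Odd N) {x : ℂ}
    (hx : TangentCone (2 * N) x) :
    ReducedBilliard N (outerSimilarity N x) (gonRoot N * (outerSimilarity N x - 2)) := by
  obtain ⟨h₁, h₂⟩ := hx.sideProj_sub_two hN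
  refine ⟨tangentCone_outerSimilarity hN hx, ?_, gonRoot N, neg_gonRoot_pow hodd, rfl⟩
  have := tangentCone_outerSimilarity_zpow_mul hN h₁ h₂ (k := -1) (by omega)
    (fun j h h' => by omega) (i := -1) le_rfl le_rfl
  rwa [neg_neg, zpow_one, ← gonRoot_mul_outerSimilarity_sub (by omega)] at this

theorem transGen_outerSimilarity_zpow_mul {N : ℕ} (hN : 3 ≤ N) (hodd : Odd N) {x : ℂ}
    (hx : TangentCone (2 * N) x) {k : ℕ} (hk : k < N)
    (h : ∀ j : ℤ, 0 ≤ j → j < k → sideProj N (2 * j + 1) (x - 2) < Real.cos (Real.pi / (2 * N))) :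
    TransGen (ReducedBilliard N) (outerSimilarity N x)
      (outerSimilarity N (gonRoot N ^ (-(k : ℤ)) * (x - 2))) := by
  have hN0 : 0 < N := by omega
  obtain ⟨h₁, h₂⟩ := hx.sideProj_sub_two hN
  have hcone : ∀ i : ℤ, -1 ≤ i → i ≤ k →
      TangentCone N (outerSimilarity N (gonRoot N ^ (-i) * (x - 2))) := fun i =>
    tangentCone_outerSimilarity_zpow_mul hN h₁ h₂ (by omega) h
  have hstep : ∀ i : ℤ, -1 ≤ i → i + 1 ≤ k →
      ReducedBilliard N (outerSimilarity N (gonRoot N ^ (-i) * (x - 2)))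
        (outerSimilarity N (gonRoot N ^ (-(i + 1)) * (x - 2))) := by
    intro i hi hik
    refine ⟨hcone i hi (by omega), hcone (i + 1) (by omega) hik, (gonRoot N)⁻¹,
      neg_inv_gonRoot_pow hodd, ?_⟩
    rw [outerSimilarity_zpow_succ_mul hN0]
  have hfirst : ReducedBilliard N (outerSimilarity N x)
      (outerSimilarity N (gonRoot N ^ (-(-1 : ℤ)) * (x - 2))) := by
    rw [neg_neg, zpow_one, ← gonRoot_mul_outerSimilarity_sub hN0]
    exact reducedBilliard_outerSimilarity hN hodd hx
  have hall : ∀ i : ℕ, i ≤ k → TransGen (ReducedBilliard N) (outerSimilarity N x)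
      (outerSimilarity N (gonRoot N ^ (-(i : ℤ)) * (x - 2))) := by
    intro i
    induction i with
    | zero =>
      exact fun _ => (TransGen.single hfirst).tail (by simpa using hstep (-1) le_rfl (by omega))
    | succ i ih =>
      intro hi
      exact (ih (by omega)).tail (by exact_mod_cast hstep i (by omega) (by omega))
  exact hall k le_rfl

theorem transGen_outerSimilarity {N : ℕ} (hN : 3 ≤ N) (hodd : Odd N) {x x' : ℂ}
    (h : ReducedBilliard (2 * N) x x') :
    TransGen (ReducedBilliard N) (outerSimilarity N x) (outerSimilarity N x') := by
  have hN0 : 0 < N := by omega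
  have hc := cos_pi_div_two_mul_pos hN
  obtain ⟨hx, hx', ρ, hρ, rfl⟩ := h
  obtain ⟨h₁, h₂⟩ := hx.sideProj_sub_two hN
  rw [(even_two_mul N).neg_pow] at hρ
  obtain ⟨k, hk, hk'⟩ := exists_gonRoot_pow hN0 (b := ρ⁻¹) (by rw [inv_pow, hρ, inv_one])
  obtain rfl : ρ = gonRoot N ^ (-(k : ℤ)) := by
    rw [zpow_neg, zpow_natCast, ← hk', inv_inv]
  rw [tangentCone_two_mul_iff_sideProj hN, sideProj_zpow_mul, sideProj_zpow_mul] at hx'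
  obtain ⟨h₃, h₄⟩ := hx'
  have hkN : k < N := by
    by_contra! hkN
    obtain hk2 | hk2 : k ≤ 2 * N - 2 ∨ k = 2 * N - 1 := by omega
    · have := sideProj_lt_of_lt hc h₁ h₂ (j := 1 + 2 * k) (by omega) (by omega)
      linarith
    · have h5 := sideProj_add_two_mul hN0 (2 * N - 1) (x - 2)
      rw [show (2 * N - 1 + 2 * N : ℤ) = 1 + 2 * k by omega] at h5
      linarith
  refine transGen_outerSimilarity_zpow_mul hN hodd hx hkN fun j hj hjk => ?_
  obtain rfl | hjk : j = k - 1 ∨ j < k - 1 := by omega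
  · rwa [show (2 * (k - 1) + 1 : ℤ) = -1 + 2 * k by ring]
  · by_contra! h5
    have := lt_sideProj_of_le hN0 hc (i := 2 * j + 1) (j := -1 + 2 * k) (k := 1 + 2 * k)
      (by omega) (by omega) (by omega) h5 h₄.le
    linarith

/-- If the reduced orbit of `outerSimilarity N x` for the `N`-gon does not end, then `x` has an
image under the reduced map of the `2N`-gon. -/
theorem exists_reducedBilliard_two_mul {N : ℕ} (hN : 3 ≤ N) (hodd : Odd N) {x : ℂ}
    (hx : TangentCone (2 * N) x)
    (hext : ∀ w, TransGen (ReducedBilliard N) (outerSimilarity N x) w →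
      ∃ w', ReducedBilliard N w w') :
    ∃ x', ReducedBilliard (2 * N) x x' := by
  classical
  have hN0 : 0 < N := by omega
  have hc := cos_pi_div_two_mul_pos hN
  obtain ⟨h₁, h₂⟩ := hx.sideProj_sub_two hN
  set c := Real.cos (Real.pi / (2 * N)) with hcdef
  have hex : ∃ k : ℕ, c < sideProj N (2 * k + 1) (x - 2) := by
    refine ⟨N - 1, ?_⟩
    rwa [show (2 * ((N - 1 : ℕ) : ℤ) + 1) = 2 * N - 1 by omega]
  obtain ⟨k, hk, hmin⟩ : ∃ k : ℕ, c < sideProj N (2 * k + 1) (x - 2) ∧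
      ∀ j < k, sideProj N (2 * j + 1) (x - 2) ≤ c :=
    ⟨Nat.find hex, Nat.find_spec hex, fun j hj => not_lt.1 (Nat.find_min hex hj)⟩
  have hkN : k < N := by
    by_contra! hkN
    have := hmin (N - 1) (by omega)
    rw [show (2 * ((N - 1 : ℕ) : ℤ) + 1) = 2 * N - 1 by omega] at this
    linarith
  have hlt : sideProj N (-1 + 2 * k) (x - 2) < c := by
    obtain rfl | ⟨m, rfl⟩ : k = 0 ∨ ∃ m, k = m + 1 := by
      cases k <;> simp
    · have h3 := sideProj_add_two_mul hN0 (-1) (x - 2)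
      rw [show (-1 + 2 * N : ℤ) = 2 * N - 1 by ring] at h3
      rw [Nat.cast_zero, mul_zero, add_zero]
      linarith
    have hm := hmin m (by omega)
    rw [show (-1 + 2 * (m + 1 : ℕ) : ℤ) = 2 * m + 1 by push_cast; ring]
    refine hm.lt_of_ne fun heq => ?_
    have hbelow : ∀ j : ℤ, 0 ≤ j → j < m → sideProj N (2 * j + 1) (x - 2) < c := by
      intro j hj hjm
      by_contra! h5
      have := lt_sideProj_of_le hN0 hc (i := 2 * j + 1) (j := 2 * m + 1)
        (k := 2 * (m + 1 : ℕ) + 1) (by omega) (by omega) (by omega) h5 hk.le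
      linarith
    obtain ⟨w', _, hw', ρ, hρ, rfl⟩ := hext _ (transGen_outerSimilarity_zpow_mul hN hodd hx
      (by omega) hbelow)
    set y := outerSimilarity N (gonRoot N ^ (-((m + 1 : ℕ) : ℤ)) * (x - 2)) with hy
    have hstep : ρ * (outerSimilarity N (gonRoot N ^ (-(m : ℤ)) * (x - 2)) - 2) =
        ρ * gonRoot N * y := by
      rw [hy, Nat.cast_succ, outerSimilarity_zpow_succ_mul hN0, mul_assoc,
        mul_inv_cancel_left₀ (gonRoot_ne_zero N)]
    have hσ : (ρ * gonRoot N) ^ N = 1 := by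
      rw [← neg_mul_neg, mul_pow, hρ, neg_gonRoot_pow hodd, one_mul]
    have hy1 : sideProj N (-2) y = Real.cos (Real.pi / N) := by
      rw [hy, sideProj_neg_two_outerSimilarity hN, sideProj_zpow_mul,
        show (-1 + 2 * (m + 1 : ℕ) : ℤ) = 2 * m + 1 by push_cast; ring, heq, cos_pi_div_eq]
      ring
    have hy2 : Real.cos (Real.pi / N) < sideProj N 2 y := by
      have h6 : -c < sideProj N (3 + 2 * (m + 1 : ℕ)) (x - 2) := by
        obtain hm2 | hm2 : m + 3 ≤ N ∨ m + 2 = N := by omega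
        · exact neg_lt_sideProj_of_lt hN hc h₁ h₂ (by omega) (by omega)
        · have h3 := sideProj_add_two_mul hN0 1 (x - 2)
          have h4 := hbelow 0 le_rfl (by omega)
          rw [mul_zero, zero_add] at h4
          rw [show (3 + 2 * (m + 1 : ℕ) : ℤ) = 1 + 2 * N by omega]
          linarith
      rw [hy, sideProj_two_outerSimilarity hN, sideProj_zpow_mul, cos_pi_div_eq, ← hcdef]
      nlinarith
    have hone : ρ * gonRoot N = 1 := by
      refine eq_one_of_tangentCone_mul hN0.ne' (im_nonpos_of_dirProj_le hN ?_ ?_) hσ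
        (hstep ▸ hw')
      · rw [← hy1, sideProj,
          show ((-2 : ℤ) : ℝ) * (Real.pi / (2 * N)) = -(Real.pi / N) by push_cast; field_simp]
      · rw [sideProj,
          show ((2 : ℤ) : ℝ) * (Real.pi / (2 * N)) = Real.pi / N by push_cast; field_simp] at hy2
        exact hy2.le
    rw [hstep, hone, one_mul, tangentCone_iff_sideProj hN, hy1] at hw'
    exact lt_irrefl _ hw'.1
  refine ⟨gonRoot N ^ (-(k : ℤ)) * (x - 2), hx, ?_, gonRoot N ^ (-(k : ℤ)), ?_, rfl⟩
  · rw [tangentCone_two_mul_iff_sideProj hN, sideProj_zpow_mul, sideProj_zpow_mul, add_comm 1]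
    exact ⟨hlt, hk⟩
  · rw [(even_two_mul N).neg_pow, zpow_neg, inv_pow, zpow_natCast, ← pow_mul, mul_comm, pow_mul,
      (isPrimitiveRoot_gonRoot hN0).pow_eq_one, one_pow, inv_one]

/-! ### Lifting the inner part of the reduced map of the `N`-gon -/

theorem inv_gonRoot_mul_innerSimilarity_sub {N : ℕ} (hN : 2 ≤ N) (z : ℂ) :
    (gonRoot N)⁻¹ * (innerSimilarity N z - 2) = innerSimilarity N ((gonRoot N)⁻¹ * (z - 2)) := by
  have h0 := gonRoot_ne_zero N
  have h1 := sub_ne_zero.2 (gonRoot_ne_one (N := N) (by omega))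
  have h2 : gonRoot N + 1 ≠ 0 := fun h => gonRoot_ne_neg_one hN (eq_neg_of_add_eq_zero_left h)
  rw [innerSimilarity, innerSimilarity,
    show gonRoot N ^ 2 - 1 = (gonRoot N - 1) * (gonRoot N + 1) by ring,
    show 1 + (gonRoot N)⁻¹ = (gonRoot N + 1) * (gonRoot N)⁻¹ by field_simp]
  field_simp
  ring

theorem inv_gonRoot_sq_mul_innerSimilarity_sub {N : ℕ} (hN : 2 ≤ N) (z : ℂ) :
    (gonRoot N)⁻¹ ^ 2 * (innerSimilarity N z - 2) =
      innerSimilarity N ((gonRoot N)⁻¹ ^ 2 * z) := by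
  have h0 := gonRoot_ne_zero N
  have h1 := sub_ne_zero.2 (gonRoot_ne_one (N := N) (by omega))
  have h2 : gonRoot N + 1 ≠ 0 := fun h => gonRoot_ne_neg_one hN (eq_neg_of_add_eq_zero_left h)
  rw [innerSimilarity, innerSimilarity,
    show gonRoot N ^ 2 - 1 = (gonRoot N - 1) * (gonRoot N + 1) by ring,
    show 1 + (gonRoot N)⁻¹ = (gonRoot N + 1) * (gonRoot N)⁻¹ by field_simp]
  field_simp
  ring

theorem exists_tangentCone_innerSimilarity {N : ℕ} (hN : 3 ≤ N) (hodd : Odd N) {z ρ : ℂ}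
    (hz : TangentCone N z) (hρ : (-ρ) ^ N = 1) (hne : ρ ≠ gonRoot N)
    (hz' : TangentCone N (ρ * (z - 2))) :
    ∃ k : ℕ, ρ = gonRoot N ^ (-(2 * k + 1 : ℤ)) ∧
      ∀ i ≤ k, TangentCone (2 * N)
        (innerSimilarity N (gonRoot N ^ (-(2 * i + 1 : ℤ)) * (z - 2))) := by
  have hN0 : 0 < N := by omega
  have hC := cos_pi_div_pos hN
  have hζ := gonRoot_ne_zero N
  have hinv : ((ρ * gonRoot N)⁻¹) ^ N = 1 := by
    rw [inv_pow, ← neg_mul_neg, mul_pow, hρ, neg_gonRoot_pow hodd, one_mul, inv_one]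
  obtain ⟨k, hk, hk'⟩ := exists_gonRoot_sq_pow hN0 hinv
  obtain rfl : ρ = gonRoot N ^ (-(2 * k + 1 : ℤ)) := by
    rw [inv_eq_iff_eq_inv] at hk'
    rw [neg_add, zpow_add₀ hζ, zpow_neg_one, eq_mul_inv_iff_mul_eq₀ hζ, hk', zpow_neg]
    norm_cast
  refine ⟨k, rfl, ?_⟩
  have hkN : k ≠ N - 1 := by
    rintro rfl
    refine hne ?_
    have h1 := (isPrimitiveRoot_gonRoot hN0).pow_eq_one
    rw [show (-(2 * ((N - 1 : ℕ) : ℤ) + 1)) = 1 - (2 * N : ℕ) by omega, zpow_sub₀ hζ,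
      zpow_natCast, h1, zpow_one, div_one]
  rw [tangentCone_iff_sideProj hN, sideProj_zpow_mul, sideProj_zpow_mul] at hz'
  rw [tangentCone_iff_sideProj hN] at hz
  obtain ⟨h₃, h₄⟩ := hz'
  have e : (2 : ℝ) * (Real.pi / (2 * N)) = Real.pi / N := by field_simp
  have h₁ : Real.cos (Real.pi / N) < sideProj N (-2 + 2 * N) (z - 2) := by
    rw [sideProj_add_two_mul hN0, sideProj_sub_two]
    push_cast
    rw [neg_mul, Real.cos_neg, e]
    linarith
  have h₂ : sideProj N (2 + 2 * N) (z - 2) < Real.cos (Real.pi / N) := by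
    rw [sideProj_add_two_mul hN0, sideProj_sub_two]
    push_cast
    rw [e]
    linarith
  obtain ⟨m, rfl⟩ := hodd
  have hkm : k < m := by
    by_contra! hmk
    obtain rfl | hmk := hmk.eq_or_lt
    · rw [show (-2 + 2 * (2 * m + 1) : ℤ) = -2 + 2 * (2 * m + 1 : ℕ) by push_cast; ring] at h₃
      linarith
    · have := lt_sideProj_of_le hN0 hC (i := -2 + 2 * (2 * m + 1 : ℕ))
        (j := 2 + 2 * (2 * m + 1 : ℕ)) (k := 2 + 2 * (2 * k + 1)) (by omega) (by omega) (by omega)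
        h₁.le h₄.le
      linarith
  intro i hi
  rw [tangentCone_two_mul_innerSimilarity_iff hN, sideProj_zpow_mul, sideProj_zpow_mul]
  constructor
  · obtain rfl | hi := hi.eq_or_lt
    · exact h₃
    · by_contra! h5
      have := lt_sideProj_of_le hN0 hC (i := -2 + 2 * (2 * i + 1)) (j := -2 + 2 * (2 * k + 1))
        (k := 2 + 2 * (2 * k + 1)) (by omega) (by omega) (by omega) h5 h₄.le
      linarith
  · by_contra! h5
    rw [← neg_neg (sideProj _ _ _), ← sideProj_add_two_mul hN0, neg_le_neg_iff] at h5
    rcases Nat.eq_zero_or_pos i with rfl | hi0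
    · rw [show (0 + 2 * (2 * (0 : ℕ) + 1) + 2 * (2 * m + 1 : ℕ) : ℤ) =
        2 + 2 * (2 * m + 1 : ℕ) by push_cast; ring] at h5
      linarith
    · have := lt_sideProj_of_le hN0 hC (i := -2 + 2 * (2 * m + 1 : ℕ))
        (j := 2 + 2 * (2 * m + 1 : ℕ)) (by omega) (by omega) (by omega) h₁.le h5
      linarith

theorem transGen_innerSimilarity {N : ℕ} (hN : 3 ≤ N) {z : ℂ}
    (hz : TangentCone (2 * N) (innerSimilarity N z)) {k : ℕ}
    (h : ∀ i ≤ k,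
      TangentCone (2 * N) (innerSimilarity N (gonRoot N ^ (-(2 * i + 1 : ℤ)) * (z - 2)))) :
    TransGen (ReducedBilliard (2 * N)) (innerSimilarity N z)
      (innerSimilarity N (gonRoot N ^ (-(2 * k + 1 : ℤ)) * (z - 2))) := by
  have hroot : ∀ j : ℕ, (-(gonRoot N)⁻¹ ^ j) ^ (2 * N) = 1 := by
    intro j
    rw [(even_two_mul N).neg_pow, ← pow_mul, mul_comm, pow_mul, inv_pow,
      (isPrimitiveRoot_gonRoot (by omega)).pow_eq_one, inv_one, one_pow]
  have hfirst : ReducedBilliard (2 * N) (innerSimilarity N z)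
      (innerSimilarity N (gonRoot N ^ (-(2 * (0 : ℕ) + 1 : ℤ)) * (z - 2))) := by
    refine ⟨hz, h 0 (Nat.zero_le k), (gonRoot N)⁻¹, by simpa using hroot 1, ?_⟩
    rw [inv_gonRoot_mul_innerSimilarity_sub (by omega), Nat.cast_zero, mul_zero, zero_add,
      zpow_neg_one]
  have hstep : ∀ i : ℕ, i + 1 ≤ k → ReducedBilliard (2 * N)
      (innerSimilarity N (gonRoot N ^ (-(2 * i + 1 : ℤ)) * (z - 2)))
      (innerSimilarity N (gonRoot N ^ (-(2 * (i + 1 : ℕ) + 1 : ℤ)) * (z - 2))) := by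
    intro i hi
    refine ⟨h i (by omega), h (i + 1) hi, (gonRoot N)⁻¹ ^ 2, hroot 2, ?_⟩
    rw [inv_gonRoot_sq_mul_innerSimilarity_sub (by omega), ← mul_assoc,
      show (-(2 * (i + 1 : ℕ) + 1 : ℤ)) = -(2 : ℕ) + -(2 * i + 1 : ℤ) by push_cast; ring,
      zpow_add₀ (gonRoot_ne_zero N), zpow_neg, zpow_natCast, inv_pow]
  have hall : ∀ i ≤ k, TransGen (ReducedBilliard (2 * N)) (innerSimilarity N z)
      (innerSimilarity N (gonRoot N ^ (-(2 * i + 1 : ℤ)) * (z - 2))) := by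
    intro i
    induction i with
    | zero => exact fun _ => .single hfirst
    | succ i ih => exact fun hi => (ih (by omega)).tail (hstep i hi)
  exact hall k le_rfl

theorem hasAcyclicOrbit_of_forall_ne {N : ℕ} (hN : 3 ≤ N) (hodd : Odd N) {h : ℤ → ℂ}
    (hinj : Function.Injective h) (horb : ∀ n, ReducedBilliard N (h n) (h (n + 1)))
    (hne : ∀ n, h (n + 1) ≠ gonRoot N * (h n - 2)) :
    HasAcyclicOrbit (ReducedBilliard (2 * N)) := by
  have key : ∀ n, ∃ k : ℕ, h (n + 1) = gonRoot N ^ (-(2 * k + 1 : ℤ)) * (h n - 2) ∧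
      ∀ i ≤ k, TangentCone (2 * N)
        (innerSimilarity N (gonRoot N ^ (-(2 * i + 1 : ℤ)) * (h n - 2))) := by
    intro n
    obtain ⟨h1, h2, ρ, hρ, he⟩ := horb n
    obtain ⟨k, rfl, hk⟩ := exists_tangentCone_innerSimilarity hN hodd h1 hρ
      (by rintro rfl; exact hne n he) (he ▸ h2)
    exact ⟨k, he, hk⟩
  refine hasAcyclicOrbit_of_transGen (reducedBilliard_rightUnique (by omega))
    (x := fun n => innerSimilarity N (h n)) ((innerSimilarity_injective (by omega)).comp hinj) ?_
  intro n
  obtain ⟨k, hk, hcone⟩ := key n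
  obtain ⟨l, hl, hcone'⟩ := key (n - 1)
  have h1 := hcone' l le_rfl
  rw [← hl, sub_add_cancel] at h1
  rw [hk]
  exact transGen_innerSimilarity hN h1 hcone

/-! ### Lifting the outer part of the reduced map of the `N`-gon -/

theorem axisReflection_outerSimilarity {N : ℕ} (hN : 0 < N) (x : ℂ) :
    outerSimilarity N (axisReflection x) =
      axisReflection (gonRoot N * (outerSimilarity N x - 2)) := by
  have h0 := gonRoot_ne_zero N
  have h1 := sub_ne_zero.2 (gonRoot_ne_one hN)
  have h2 := sub_ne_zero.2 (gonRoot_ne_one hN).symm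
  have hconj : (starRingEnd ℂ) (gonRoot N) = (gonRoot N)⁻¹ := by
    rw [gonRoot, ← exp_conj, map_mul, conj_ofReal, conj_I, mul_neg, exp_neg]
  simp only [outerSimilarity, axisReflection, map_add,
    map_mul, map_sub, map_div₀, map_neg, map_inv₀, map_one, map_ofNat, hconj, inv_inv]
  have h3 : (gonRoot N)⁻¹ - 1 = (1 - gonRoot N) * (gonRoot N)⁻¹ := by field_simp
  rw [h3]
  field_simp
  ring

theorem outerSimilarity_surjective {N : ℕ} (hN : 2 ≤ N) :
    Function.Surjective (outerSimilarity N) := by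
  intro w
  have h1 := one_add_inv_gonRoot_ne_zero hN
  refine ⟨(1 + (gonRoot N)⁻¹)⁻¹ * (w - -2 / (gonRoot N - 1)), ?_⟩
  rw [outerSimilarity, mul_inv_cancel_left₀ h1, sub_add_cancel]

theorem tangentCone_two_mul_of_outerSimilarity {N : ℕ} (hN : 3 ≤ N) {x : ℂ}
    (h₁ : TangentCone N (outerSimilarity N x))
    (h₂ : TangentCone N (gonRoot N * (outerSimilarity N x - 2))) : TangentCone (2 * N) x := by
  rw [gonRoot_mul_outerSimilarity_sub (by omega), ← zpow_one (gonRoot N),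
    show (1 : ℤ) = -(-1) by norm_num, tangentCone_outerSimilarity_iff hN, sideProj_zpow_mul,
    sideProj_zpow_mul, sideProj_sub_two, sideProj_sub_two] at h₂
  rw [tangentCone_outerSimilarity_iff hN] at h₁
  rw [tangentCone_two_mul_iff_sideProj hN]
  have h := h₂.2
  norm_num at h
  exact ⟨h₁.1, by linarith⟩

theorem exists_reducedBilliard_two_mul_of_orbit {N : ℕ} (hN : 3 ≤ N) (hodd : Odd N) {h : ℤ → ℂ}
    (horb : ∀ n, ReducedBilliard N (h n) (h (n + 1))) {n : ℤ} {x : ℂ}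
    (hn : h n = outerSimilarity N x) (hx : TangentCone (2 * N) x) :
    ∃ x', ReducedBilliard (2 * N) x x' := by
  refine exists_reducedBilliard_two_mul hN hodd hx fun w hw => ?_
  obtain ⟨m, -, rfl⟩ := exists_later_of_transGen (reducedBilliard_rightUnique (by omega)) horb
    (hn ▸ hw)
  exact ⟨_, horb m⟩

theorem hasAcyclicOrbit_of_exists_eq {N : ℕ} (hN : 3 ≤ N) (hodd : Odd N) {h : ℤ → ℂ}
    (hinj : Function.Injective h) (horb : ∀ n, ReducedBilliard N (h n) (h (n + 1))) {n₀ : ℤ}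
    (heq : h (n₀ + 1) = gonRoot N * (h n₀ - 2)) :
    HasAcyclicOrbit (ReducedBilliard (2 * N)) := by
  have hN0 : N ≠ 0 := by omega
  have hru := reducedBilliard_rightUnique hN0
  obtain ⟨x₀, hx₀⟩ := outerSimilarity_surjective (N := N) (by omega) (h n₀)
  refine ⟨{x | ∃ n, h n = outerSimilarity N x ∧ TangentCone (2 * N) x}, ?_, ?_, x₀,
    ⟨n₀, hx₀.symm, ?_⟩, ?_⟩
  · rintro x ⟨n, hn, hx⟩
    obtain ⟨x', hx'⟩ := exists_reducedBilliard_two_mul_of_orbit hN hodd horb hn hx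
    obtain ⟨m, -, hm⟩ := exists_later_of_transGen hru horb
      (hn ▸ transGen_outerSimilarity hN hodd hx')
    exact ⟨x', ⟨m, hm.symm, hx'.2.1⟩, hx'⟩
  · rintro x ⟨n, hn, hx⟩
    have horb' : ∀ m : ℤ,
        ReducedBilliard N (axisReflection (h (-m))) (axisReflection (h (-(m + 1)))) := by
      intro m
      have := (horb (-(m + 1))).axisReflection_swap hN0
      rwa [show -(m + 1) + 1 = -m by ring] at this
    have hnext : h (n + 1) = gonRoot N * (outerSimilarity N x - 2) :=
      hru (hn ▸ horb n) (reducedBilliard_outerSimilarity hN hodd hx)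
    obtain ⟨w, hw⟩ := exists_reducedBilliard_two_mul_of_orbit hN hodd
      (h := fun m => axisReflection (h (-m))) horb' (n := -(n + 1)) (x := axisReflection x)
      (by rw [neg_neg, hnext, axisReflection_outerSimilarity (by omega)]) hx.axisReflection
    have hw' := hw.axisReflection_swap (by omega)
    rw [axisReflection_axisReflection] at hw'
    obtain ⟨m, -, hm⟩ := exists_earlier_of_transGen (reducedBilliard_leftUnique hN0) horb
      (hn ▸ transGen_outerSimilarity hN hodd hw')
    exact ⟨_, ⟨m, hm.symm, hw'.1⟩, hw'⟩
  · obtain ⟨h1, h2, -⟩ := horb n₀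
    rw [heq, ← hx₀] at h2
    exact tangentCone_two_mul_of_outerSimilarity hN (hx₀ ▸ h1) h2
  · intro hc
    have hc' : TransGen (ReducedBilliard N) (outerSimilarity N x₀) (outerSimilarity N x₀) :=
      hc.lift' (outerSimilarity N) fun _ _ => transGen_outerSimilarity hN hodd
    obtain ⟨m, hm, heq_m⟩ := exists_later_of_transGen hru horb (n := n₀) (hx₀ ▸ hc')
    exact hm.ne (hinj heq_m)

/-- For odd `N > 3`, the dual billiard outside the regular `N`-gon has an aperiodic point
if and only if the dual billiard outside the regular `2N`-gon has an aperiodic point. -/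
theorem dual_billiard_aperiodic_iff (N : ℕ) (hN : 3 < N) (hodd : Odd N) :
    (∃ z : ℂ, IsAperiodicPt N z) ↔ (∃ z : ℂ, IsAperiodicPt (2 * N) z) := by
  constructor
  · rintro ⟨z, hz⟩
    obtain ⟨h, hinj, horb⟩ := exists_reduced_orbit_of_isAperiodicPt (by omega) hz
    refine exists_isAperiodicPt_of_hasAcyclicOrbit (by omega) ?_
    by_cases hne : ∀ n, h (n + 1) ≠ gonRoot N * (h n - 2)
    · exact hasAcyclicOrbit_of_forall_ne hN.le hodd hinj horb hne
    · push Not at hne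
      obtain ⟨n₀, heq⟩ := hne
      exact hasAcyclicOrbit_of_exists_eq hN.le hodd hinj horb heq
  · rintro ⟨z, hz⟩
    obtain ⟨x, hinj, horb⟩ := exists_reduced_orbit_of_isAperiodicPt (by omega) hz
    refine exists_isAperiodicPt_of_hasAcyclicOrbit (by omega) ?_
    exact hasAcyclicOrbit_of_transGen (reducedBilliard_rightUnique (by omega))
      (x := fun n => outerSimilarity N (x n)) ((outerSimilarity_injective (by omega)).comp hinj)
      fun n => transGen_outerSimilarity hN.le hodd (horb n)
end
end

section
/- For each k = 0, …, 2N−1, the orientation-reversing isometry r_k(z) = 2 − ζ^k(2 − conj(z)) of ℂ satisfies r_k(r_k(z)) = z for all z ∈ ℂ, maps the piece P_k onto itself (r_k(P_k) = P_k), and satisfies f_1(z) = u_1(r_k(z)) for all z ∈ P_k, where u_1(z) = 2 − conj(z). Consequently, the map v_1 = u_1 ∘ f_1, given on P_k by v_1(z) = 2 − ζ^k(2 − conj(z)), satisfies v_1(v_1(z)) = z for every z in the domain of f_1; that is, (u_1, v_1) is a symmetric Nous pair for f_1. -/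
open Complex

noncomputable section

/-- `ζ = exp(iπ/N)`, a primitive `2N`-th root of unity. -/
def zeta (N : ℕ) : ℂ := Complex.exp (Real.pi * Complex.I / N)

/-- The regular `2N`-gon: the interior of the convex hull of the `2N`-th roots of unity. -/
def Pgon (N : ℕ) : Set ℂ := interior (convexHull ℝ {a : ℂ | a ^ (2 * N) = 1})

/-- The set `V_k`: points `z` outside the closure of the regular `2N`-gon such that every
vertex `ζ^j` with `j ≢ k (mod 2N)` lies strictly on the right of the oriented line from `z`
to `ζ^k`. -/
def Vcone (N : ℕ) (k : ℤ) : Set ℂ :=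
  {z : ℂ | z ∉ closure (Pgon N) ∧
    ∀ j : ℤ, ¬ ((2 * N : ℤ) ∣ (j - k)) → StrictlyRight z (zeta N ^ k) (zeta N ^ j)}

/-- The piece `P_k = v_0(V_0 ∩ f_Π(V_{-k}))`, where `v_0(z) = 2 - conj z` and
`f_Π` acts on `V_{-k}` by `z ↦ 2ζ^{-k} - z`. -/
def Ppiece (N : ℕ) (k : ℤ) : Set ℂ :=
  (fun z : ℂ => 2 - (starRingEnd ℂ) z) ''
    (Vcone N 0 ∩ ((fun z : ℂ => 2 * zeta N ^ (-k) - z) '' Vcone N (-k)))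

/-- The orientation-reversing isometry `r_k(z) = 2 - ζ^k (2 - conj z)`. -/
def rmap (N k : ℕ) (z : ℂ) : ℂ := 2 - zeta N ^ k * (2 - (starRingEnd ℂ) z)

/-- The reflection `u_1(z) = 2 - conj z`. -/
def u1 (z : ℂ) : ℂ := 2 - (starRingEnd ℂ) z

lemma zeta_isPrimitiveRoot {N : ℕ} (hN : 0 < N) : IsPrimitiveRoot (zeta N) (2 * N) := by
  have h := Complex.isPrimitiveRoot_exp (2 * N) (by omega)
  have hN' : (N : ℂ) ≠ 0 := by exact_mod_cast hN.ne'
  convert h using 1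
  unfold zeta
  congr 1
  push_cast
  field_simp

lemma zeta_ne_zero (N : ℕ) : zeta N ≠ 0 := Complex.exp_ne_zero _

lemma conj_zeta (N : ℕ) : (starRingEnd ℂ) (zeta N) = (zeta N)⁻¹ := by
  unfold zeta
  rw [← Complex.exp_conj, ← Complex.exp_neg]
  congr 1
  simp [neg_div]

lemma conj_zeta_zpow (N : ℕ) (k : ℤ) :
    (starRingEnd ℂ) (zeta N ^ k) = zeta N ^ (-k) := by
  rw [map_zpow₀, conj_zeta, inv_zpow, zpow_neg]

lemma convex_insert_strictlyRight (z a : ℂ) :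
    Convex ℝ (insert a {w | StrictlyRight z a w}) := by
  rw [convex_iff_forall_pos]
  have key : ∀ x y : ℂ, ∀ s t : ℝ, s + t = 1 →
      ((starRingEnd ℂ) (a - z) * ((s • x + t • y) - z)).im =
        s * ((starRingEnd ℂ) (a - z) * (x - z)).im +
          t * ((starRingEnd ℂ) (a - z) * (y - z)).im := by
    intro x y s t hst
    obtain rfl : t = 1 - s := by linarith
    simp
    ring
  have ha : ((starRingEnd ℂ) (a - z) * (a - z)).im = 0 := by
    simp
    ring
  rintro x (rfl | hx) y (rfl | hy) s t hs ht hst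
  · left
    rw [← add_smul, hst, one_smul]
  all_goals
    right
    simp only [Set.mem_ofPred_eq, StrictlyRight] at *
    rw [key _ _ _ _ hst]
    nlinarith

/-- A point from which all other vertices of the polygon lie strictly to the right of the line
to `ζ^k` is automatically outside the closed polygon. -/
lemma mem_Vcone_iff {N : ℕ} (hN : 0 < N) (k : ℤ) (z : ℂ) :
    z ∈ Vcone N k ↔
      ∀ j : ℤ, ¬ ((2 * N : ℤ) ∣ (j - k)) → StrictlyRight z (zeta N ^ k) (zeta N ^ j) := by
  refine ⟨fun h => h.2, fun h => ⟨fun hz => ?_, h⟩⟩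
  have hζ := zeta_isPrimitiveRoot hN
  have : NeZero (2 * N) := ⟨by omega⟩
  have hroot : ∀ a : ℂ, a ^ (2 * N) = 1 → ∃ i : ℕ, zeta N ^ i = a := fun a ha => by
    obtain ⟨i, -, hi⟩ := hζ.eq_pow_of_pow_eq_one ha
    exact ⟨i, hi⟩
  have hfin : {a : ℂ | a ^ (2 * N) = 1}.Finite := by
    refine (Polynomial.nthRootsFinset (2 * N) (1 : ℂ)).finite_toSet.subset fun a ha => ?_
    simpa [Polynomial.mem_nthRootsFinset (show 0 < 2 * N by omega)] using ha
  have hhull : z ∈ convexHull ℝ {a : ℂ | a ^ (2 * N) = 1} :=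
    closure_minimal interior_subset (hfin.isClosed_convexHull ℝ) hz
  have hsub : {a : ℂ | a ^ (2 * N) = 1} ⊆
      insert (zeta N ^ k) {w | StrictlyRight z (zeta N ^ k) w} := by
    intro a ha
    obtain ⟨i, rfl⟩ := hroot a ha
    by_cases hd : (2 * N : ℤ) ∣ ((i : ℤ) - k)
    · left
      have h1 : zeta N ^ ((i : ℤ) - k) = 1 :=
        (hζ.zpow_eq_one_iff_dvd _).2 (by exact_mod_cast hd)
      rw [zpow_sub₀ (zeta_ne_zero N), div_eq_one_iff_eq (zpow_ne_zero _ (zeta_ne_zero N))] at h1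
      exact_mod_cast h1
    · right
      exact_mod_cast h i hd
  rcases convexHull_min hsub (convex_insert_strictlyRight _ _) hhull with hz' | hz'
  · have h1 := h (k + 1) (by
      rw [add_sub_cancel_left]
      intro hd
      have := Int.le_of_dvd one_pos hd
      omega)
    rw [← hz'] at h1
    simp [StrictlyRight] at h1
  · simp [StrictlyRight] at hz'

lemma zeta_zpow_mul_mem_Vcone_iff {N : ℕ} (hN : 0 < N) (k : ℤ) (z : ℂ) :
    zeta N ^ k * z ∈ Vcone N k ↔ z ∈ Vcone N 0 := by
  have hrot : ∀ w : ℂ, StrictlyRight (zeta N ^ k * z) (zeta N ^ k) (zeta N ^ k * w) ↔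
      StrictlyRight z 1 w := by
    intro w
    have : (starRingEnd ℂ) (zeta N ^ k - zeta N ^ k * z) * (zeta N ^ k * w - zeta N ^ k * z) =
        (starRingEnd ℂ) (1 - z) * (w - z) := by
      have h1 : zeta N ^ (-k) * zeta N ^ k = 1 := by
        rw [← zpow_add₀ (zeta_ne_zero N)]
        simp
      simp only [map_sub, map_mul, conj_zeta_zpow, map_one]
      linear_combination (1 - (starRingEnd ℂ) z) * (w - z) * h1
    rw [StrictlyRight, StrictlyRight, this]
  rw [mem_Vcone_iff hN, mem_Vcone_iff hN]
  constructor
  · intro h j hj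
    have := h (k + j) (by simpa using hj)
    rw [zpow_add₀ (zeta_ne_zero N), hrot] at this
    simpa using this
  · intro h j hj
    have := h (j - k) (by simpa using hj)
    rw [zpow_zero, ← hrot, ← zpow_add₀ (zeta_ne_zero N)] at this
    simpa using this

lemma two_sub_conj_mem_Vcone_zero {N : ℕ} (hN : 0 < N) {z : ℂ} (hz : z ∈ Vcone N 0) :
    2 - (starRingEnd ℂ) z ∈ Vcone N 0 := by
  rw [mem_Vcone_iff hN] at hz ⊢
  intro j hj
  have h := hz (-j) (by simpa using hj)
  rw [← conj_zeta_zpow] at h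
  simp only [StrictlyRight, zpow_zero] at h ⊢
  generalize zeta N ^ j = w at h ⊢
  simp at h ⊢
  linarith

lemma mem_Ppiece_iff {N : ℕ} (hN : 0 < N) (k : ℤ) (z : ℂ) :
    z ∈ Ppiece N k ↔ z ∈ Vcone N 0 ∧ zeta N ^ (-k) * (2 - z) ∈ Vcone N 0 := by
  have hinv : ∀ w : ℂ, 2 - (starRingEnd ℂ) w ∈ Vcone N 0 ↔ w ∈ Vcone N 0 := fun w =>
    ⟨fun h => by simpa [Complex.conj_ofNat] using two_sub_conj_mem_Vcone_zero hN h, two_sub_conj_mem_Vcone_zero hN⟩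
  have h1 : zeta N ^ (-k) * zeta N ^ k = 1 := by
    rw [← zpow_add₀ (zeta_ne_zero N)]
    simp
  have hcone : ∀ y : ℂ, 2 * zeta N ^ (-k) - y ∈ Vcone N (-k) ↔
      (starRingEnd ℂ) (zeta N ^ k * y) ∈ Vcone N 0 := by
    intro y
    rw [← hinv, Complex.conj_conj, ← zeta_zpow_mul_mem_Vcone_iff hN (-k)]
    have : zeta N ^ (-k) * (2 - zeta N ^ k * y) = 2 * zeta N ^ (-k) - y := by
      linear_combination -y * h1
    rw [this]
  have hy : ∀ y : ℂ, zeta N ^ (-k) * (2 - (2 - (starRingEnd ℂ) y)) =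
      (starRingEnd ℂ) (zeta N ^ k * y) := by
    intro y
    rw [map_mul, conj_zeta_zpow]
    ring
  constructor
  · rintro ⟨y, ⟨hy0, x, hx, rfl⟩, rfl⟩
    refine ⟨(hinv _).2 hy0, ?_⟩
    simp only
    rw [hy, ← hcone]
    simpa using hx
  · rintro ⟨hz0, hz1⟩
    refine ⟨2 - (starRingEnd ℂ) z, ⟨(hinv _).2 hz0,
      2 * zeta N ^ (-k) - (2 - (starRingEnd ℂ) z), ?_, by simp⟩, by simp [Complex.conj_ofNat]⟩
    rw [hcone, ← hy]
    simpa [Complex.conj_ofNat] using hz1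

lemma u1_rmap (N k : ℕ) (z : ℂ) : u1 (rmap N k z) = zeta N ^ (-(k : ℤ)) * (2 - z) := by
  have h := conj_zeta_zpow N k
  rw [zpow_natCast] at h
  simp only [u1, rmap, map_sub, map_mul, h, Complex.conj_conj, Complex.conj_ofNat]
  ring

lemma rmap_rmap (N k : ℕ) (z : ℂ) : rmap N k (rmap N k z) = z := by
  have h : rmap N k (rmap N k z) = 2 - zeta N ^ k * u1 (rmap N k z) := rfl
  rw [h, u1_rmap, zpow_neg, zpow_natCast, mul_inv_cancel_left₀ (pow_ne_zero _ (zeta_ne_zero N))]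
  ring

lemma rmap_mem_Ppiece {N : ℕ} (hN : 0 < N) {k : ℕ} {z : ℂ} (hz : z ∈ Ppiece N k) :
    rmap N k z ∈ Ppiece N k := by
  rw [mem_Ppiece_iff hN, ← u1_rmap] at hz ⊢
  rw [rmap_rmap]
  refine ⟨?_, two_sub_conj_mem_Vcone_zero hN hz.1⟩
  simpa [u1, Complex.conj_ofNat] using two_sub_conj_mem_Vcone_zero hN hz.2

/-- For odd `N > 3` and each `k < 2N`: the map `r_k(z) = 2 - ζ^k(2 - conj z)` is an
involution of `ℂ`, maps `P_k` onto itself, and satisfies `f_1 = u_1 ∘ r_k` on `P_k`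
(where `f_1(z) = ζ^{-k}(2 - z)` on `P_k` and `u_1(z) = 2 - conj z`).  Consequently any map
`v_1` that agrees with `r_k` on each piece `P_k` satisfies `v_1(v_1 z) = z` on the domain
`P_0 ∪ ⋯ ∪ P_{2N-1}` of `f_1`; that is, `(u_1, v_1)` is a symmetric Nous pair for `f_1`. -/
theorem symmetric_nous_pair_for_f1 (N : ℕ) (hN : 3 < N) (hodd : Odd N) :
    (∀ k : ℕ, k < 2 * N →
      (∀ z : ℂ, rmap N k (rmap N k z) = z) ∧
      rmap N k '' Ppiece N (k : ℤ) = Ppiece N (k : ℤ) ∧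
      (∀ z ∈ Ppiece N (k : ℤ), zeta N ^ (-(k : ℤ)) * (2 - z) = u1 (rmap N k z))) ∧
    (∀ v1 : ℂ → ℂ,
      (∀ k : ℕ, k < 2 * N → ∀ z ∈ Ppiece N (k : ℤ), v1 z = rmap N k z) →
      ∀ z ∈ ⋃ k ∈ Finset.range (2 * N), Ppiece N (k : ℤ), v1 (v1 z) = z) := by
  have hN0 : 0 < N := by omega
  refine ⟨fun k _ => ⟨rmap_rmap N k, ?_, fun z _ => (u1_rmap N k z).symm⟩, ?_⟩
  · refine Set.Subset.antisymm ?_ fun z hz => ⟨_, rmap_mem_Ppiece hN0 hz, rmap_rmap N k z⟩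
    rintro _ ⟨z, hz, rfl⟩
    exact rmap_mem_Ppiece hN0 hz
  · intro v1 hv z hz
    simp only [Set.mem_iUnion, Finset.mem_range] at hz
    obtain ⟨k, hk, hz⟩ := hz
    rw [hv k hk z hz, hv k hk _ (rmap_mem_Ppiece hN0 hz), rmap_rmap]
end
end

section
/- Every periodic interval exchange transformation has zero SAF invariant: if f is an IET of [0,1) presented by data 0 = c_0 < c_1 < … < c_n = 1 and translations t_1, …, t_n, and f^p = id for some integer p ≥ 1, then Σ_{i=1}^n (c_i − c_{i−1}) ⊗ t_i = 0 in ℝ ⊗_ℚ ℝ. -/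
open scoped TensorProduct

noncomputable section

/-- `(n, c, t)` is presenting data for the interval exchange transformation `f` of `[0,1)`:
`0 = c 0 < c 1 < ⋯ < c n = 1`, the map `f` is a bijection of `[0,1)`, and `f x = x + t i`
on each interval `[c i, c (i+1))`, `i = 0, …, n - 1`. -/
def IsIETData (f : ℝ → ℝ) (n : ℕ) (c t : ℕ → ℝ) : Prop :=
  0 < n ∧ c 0 = 0 ∧ c n = 1 ∧ (∀ i < n, c i < c (i + 1)) ∧
  Set.BijOn f (Set.Ico 0 1) (Set.Ico 0 1) ∧
  ∀ i < n, ∀ x ∈ Set.Ico (c i) (c (i + 1)), f x = x + t i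

/-- The Sah–Arnoux–Fathi invariant of the presenting data `(n, c, t)`:
`Σ_{i} (c (i+1) - c i) ⊗ t i ∈ ℝ ⊗_ℚ ℝ`. -/
noncomputable def SAF (n : ℕ) (c t : ℕ → ℝ) : ℝ ⊗[ℚ] ℝ :=
  ∑ i ∈ Finset.range n, (c (i + 1) - c i) ⊗ₜ[ℚ] t i

open MeasureTheory Set

/-- A finite sum of pure tensors in `ℝ ⊗[ℚ] ℝ` vanishes as soon as every `ℚ`-linear functional
of the second factor sends it to zero. -/
lemma sum_tmul_eq_zero_of_forall_linearMap {ι : Type*} (s : Finset ι) (a b : ι → ℝ)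
    (h : ∀ φ : ℝ →ₗ[ℚ] ℝ, ∑ i ∈ s, a i * φ (b i) = 0) :
    ∑ i ∈ s, a i ⊗ₜ[ℚ] b i = 0 := by
  let B := Module.Basis.ofVectorSpace ℚ ℝ
  refine (B.baseChange ℝ).ext_elem fun j => ?_
  have hj := h ((Algebra.linearMap ℚ ℝ).comp (B.coord j))
  simp only [map_sum, Finsupp.coe_finsetSum, Finset.sum_apply, map_zero, Finsupp.coe_zero,
    Pi.zero_apply, Module.Basis.baseChange_repr_tmul]
  rw [← hj]
  refine Finset.sum_congr rfl fun i _ => ?_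
  simp [Rat.smul_def, mul_comm]

/-- Consecutive half-open intervals fill up the whole interval. -/
lemma biUnion_range_Ico_of_le {c : ℕ → ℝ} {n : ℕ} (hc : ∀ i < n, c i ≤ c (i + 1)) :
    c 0 ≤ c n ∧ ⋃ i ∈ Finset.range n, Ico (c i) (c (i + 1)) = Ico (c 0) (c n) := by
  induction n with
  | zero => simp
  | succ n ih =>
    obtain ⟨h0, hU⟩ := ih fun i hi => hc i (by omega)
    refine ⟨h0.trans (hc n (by omega)), ?_⟩
    rw [Finset.range_add_one, Finset.set_biUnion_insert, hU, union_comm,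
      Ico_union_Ico_eq_Ico h0 (hc n (by omega))]

lemma pairwise_disjoint_Ico_of_le {c : ℕ → ℝ} {n : ℕ} (hc : ∀ i < n, c i ≤ c (i + 1)) :
    (Finset.range n : Set ℕ).Pairwise
      (Function.onFun Disjoint fun i => Ico (c i) (c (i + 1))) := by
  have hmono : ∀ j ≤ n, ∀ i ≤ j, c i ≤ c j := by
    intro j
    induction j with
    | zero => intro _ i hi; simp [Nat.le_zero.1 hi]
    | succ j ih =>
      intro hj i hi
      rcases Nat.lt_or_ge j i with h | h
      · rw [show i = j + 1 by omega]
      · exact (ih (by omega) i h).trans (hc j (by omega))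
  intro i hi j hj hij
  simp only [Finset.coe_range, mem_Iio] at hi hj
  refine disjoint_left.2 fun x hx hx' => ?_
  rcases Nat.lt_or_gt_of_ne hij with h | h
  · exact absurd (hmono j hj.le (i + 1) h) (not_le.2 (hx'.1.trans_lt hx.2))
  · exact absurd (hmono i hi.le (j + 1) h) (not_le.2 (hx.1.trans_lt hx'.2))

namespace IsIETData

variable {f : ℝ → ℝ} {n : ℕ} {c t : ℕ → ℝ}

lemma biUnion_Ico (h : IsIETData f n c t) :
    ⋃ i ∈ Finset.range n, Ico (c i) (c (i + 1)) = Ico 0 1 := by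
  obtain ⟨-, h0, h1, hc, -, -⟩ := h
  rw [(biUnion_range_Ico_of_le fun i hi => (hc i hi).le).2, h0, h1]

lemma Ico_subset (h : IsIETData f n c t) {i : ℕ} (hi : i < n) :
    Ico (c i) (c (i + 1)) ⊆ Ico 0 1 := by
  rw [← h.biUnion_Ico]
  exact Finset.subset_set_biUnion_of_mem (f := fun i => Ico (c i) (c (i + 1)))
    (Finset.mem_range.2 hi)

lemma setIntegral_eq_sum (h : IsIETData f n c t) {g : ℝ → ℝ} (hg : IntegrableOn g (Ico 0 1)) :
    ∫ x in Ico 0 1, g x = ∑ i ∈ Finset.range n, ∫ x in Ico (c i) (c (i + 1)), g x := by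
  rw [← h.biUnion_Ico]
  exact integral_biUnion_finset _ (fun i _ => measurableSet_Ico)
    (pairwise_disjoint_Ico_of_le fun i hi => (h.2.2.2.1 i hi).le)
    fun i hi => hg.mono_set (h.Ico_subset (Finset.mem_range.1 hi))

/-- An interval exchange transformation preserves Lebesgue integrals over `[0,1)`. -/
lemma integrableOn_comp_and_setIntegral_comp (h : IsIETData f n c t) {g : ℝ → ℝ}
    (hg : IntegrableOn g (Ico 0 1)) :
    IntegrableOn (g ∘ f) (Ico 0 1) ∧ ∫ x in Ico 0 1, (g ∘ f) x = ∫ x in Ico 0 1, g x := by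
  have hbij := h.2.2.2.2.1
  have hderiv : ∀ i < n, ∀ x ∈ Ico (c i) (c (i + 1)),
      HasDerivWithinAt f 1 (Ico (c i) (c (i + 1))) x := fun i hi x hx =>
    ((hasDerivWithinAt_id x _).add_const (t i)).congr (fun y hy => h.2.2.2.2.2 i hi y hy)
      (h.2.2.2.2.2 i hi x hx)
  have hinj : ∀ i < n, InjOn f (Ico (c i) (c (i + 1))) := fun i hi =>
    hbij.injOn.mono (h.Ico_subset hi)
  have himage : ⋃ i ∈ Finset.range n, f '' Ico (c i) (c (i + 1)) = Ico 0 1 := by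
    rw [← image_iUnion₂, h.biUnion_Ico, hbij.image_eq]
  have hsub : ∀ i < n, f '' Ico (c i) (c (i + 1)) ⊆ Ico 0 1 := fun i hi =>
    (image_mono (h.Ico_subset hi)).trans hbij.image_eq.subset
  have hcomp : IntegrableOn (g ∘ f) (Ico 0 1) := by
    rw [← h.biUnion_Ico, integrableOn_finset_iUnion]
    intro i hi
    rw [Finset.mem_range] at hi
    simpa [Function.comp_def] using (integrableOn_image_iff_integrableOn_abs_deriv_smul
      measurableSet_Ico (hderiv i hi) (hinj i hi) g).1 (hg.mono_set (hsub i hi))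
  refine ⟨hcomp, ?_⟩
  rw [h.setIntegral_eq_sum hcomp, ← himage, integral_biUnion_finset]
  · refine Finset.sum_congr rfl fun i hi => ?_
    rw [Finset.mem_range] at hi
    simpa using (integral_image_eq_integral_abs_deriv_smul
      measurableSet_Ico (hderiv i hi) (hinj i hi) g).symm
  · intro i hi
    rw [Finset.mem_range] at hi
    exact measurableSet_Ico.image_of_continuousOn_injOn
      (fun x hx => (hderiv i hi x hx).continuousWithinAt) (hinj i hi)
  · intro i hi j hj hij
    have hd := pairwise_disjoint_Ico_of_le (fun i hi => (h.2.2.2.1 i hi).le) hi hj hij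
    simp only [Finset.coe_range, mem_Iio] at hi hj
    exact hd.image hbij.injOn (h.Ico_subset hi) (h.Ico_subset hj)
  · exact fun i hi => hg.mono_set (hsub i (Finset.mem_range.1 hi))

lemma integrableOn_comp_iterate_and_setIntegral_comp_iterate (h : IsIETData f n c t)
    {g : ℝ → ℝ} (hg : IntegrableOn g (Ico 0 1)) (k : ℕ) :
    IntegrableOn (g ∘ f^[k]) (Ico 0 1) ∧
      ∫ x in Ico 0 1, (g ∘ f^[k]) x = ∫ x in Ico 0 1, g x := by
  induction k with
  | zero => exact ⟨hg, rfl⟩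
  | succ k ih =>
    rw [Function.iterate_succ, ← Function.comp_assoc]
    have := h.integrableOn_comp_and_setIntegral_comp ih.1
    exact ⟨this.1, this.2.trans ih.2⟩

/-- The integral of a function of the displacement `f x - x`. -/
lemma integrableOn_and_setIntegral_displacement (h : IsIETData f n c t) (φ : ℝ → ℝ) :
    IntegrableOn (fun x => φ (f x - x)) (Ico 0 1) ∧
      ∫ x in Ico 0 1, φ (f x - x) = ∑ i ∈ Finset.range n, (c (i + 1) - c i) * φ (t i) := by
  have heq : ∀ i < n, EqOn (fun x => φ (f x - x)) (fun _ => φ (t i)) (Ico (c i) (c (i + 1))) :=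
    fun i hi x hx => by simp [h.2.2.2.2.2 i hi x hx]
  have hint : IntegrableOn (fun x => φ (f x - x)) (Ico 0 1) := by
    rw [← h.biUnion_Ico, integrableOn_finset_iUnion]
    intro i hi
    refine IntegrableOn.congr_fun ?_ (heq i (Finset.mem_range.1 hi)).symm measurableSet_Ico
    exact integrableOn_const (by simp)
  refine ⟨hint, ?_⟩
  rw [h.setIntegral_eq_sum hint]
  refine Finset.sum_congr rfl fun i hi => ?_
  rw [Finset.mem_range] at hi
  rw [setIntegral_congr_fun measurableSet_Ico (heq i hi), setIntegral_const,
    Real.volume_real_Ico_of_le (h.2.2.2.1 i hi).le, smul_eq_mul]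

end IsIETData

/-- Every periodic interval exchange transformation of `[0,1)` has vanishing SAF
invariant. -/
theorem periodic_IET_SAF_zero (f : ℝ → ℝ) (n : ℕ) (c t : ℕ → ℝ)
    (h : IsIETData f n c t) (p : ℕ) (hp : 1 ≤ p)
    (hper : ∀ x ∈ Set.Ico (0 : ℝ) 1, f^[p] x = x) :
    SAF n c t = 0 := by
  refine sum_tmul_eq_zero_of_forall_linearMap _ _ _ fun φ => ?_
  obtain ⟨hint, hval⟩ := h.integrableOn_and_setIntegral_displacement φ
  rw [← hval]
  have hiter := h.integrableOn_comp_iterate_and_setIntegral_comp_iterate hint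
  have hsum : ∫ x in Ico (0 : ℝ) 1,
      ∑ k ∈ Finset.range p, ((fun x => φ (f x - x)) ∘ f^[k]) x = 0 := by
    refine setIntegral_eq_zero_of_forall_eq_zero fun x hx => ?_
    simp only [Function.comp_apply, ← Function.iterate_succ_apply', map_sub]
    rw [Finset.sum_range_sub fun k => φ (f^[k] x), hper x hx]
    simp
  rw [integral_finsetSum _ fun k _ => (hiter k).1,
    Finset.sum_congr rfl fun k _ => (hiter k).2] at hsum
  have hp0 : (p : ℝ) ≠ 0 := by positivity
  simpa [hp0] using hsum
end
end
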